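/- arXiv:1008.1266 — 2 statements merged into one kernel-verified Lean document; each statement's English description precedes it below -/
import Mathlib

section
/- Assume (H1) and the hypotheses under which E_0 is strictly minimized at the corners of Δ (either d ≥ 2 and q ≠ 0 sign-definite, or d = 1 and E_0(a) ≠ −2 for some a). Let E_min = inf_{ω'∈Ω} min σ(h_{ω'}). If ω ∈ Ω is L-periodic (ω_{i+nL} = ω_i for all i, n ∈ ℤ^d, where nL = (n_i L_i)_i) and min σ(h_ω) = E_min, then: (1) every ω_k is a corner of Δ, i.e. (ω_k)_i ∈ {0, M_i−b_i} for all i; (2) E_min = min σ(h^N_{0,Λ̲} + V_ω|_{Λ̲}) where Λ̲ = ∏_{i=1}^d [1, L_i M_i] is a period cell of V_ω; and (3) the restriction of the positive Neumann ground state on Λ̲ to each translate Λ_k = Λ + (k−1)M (k ∈ ∏[1,L_i]) is a ground state of h^N_{0,Λ_k} + V_ω|_{Λ_k} with eigenvalue E_min. -/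
open scoped BigOperators

noncomputable section

/-- Points of the lattice `ℤ^d`. -/
abbrev Zd (d : ℕ) := Fin d → ℤ

/-- 1-norm distance on `ℤ^d`. -/
def dist1 {d : ℕ} (x y : Zd d) : ℤ := ∑ i, |x i - y i|

/-- The set of nearest neighbors of a point of `ℤ^d`. -/
def nbhd {d : ℕ} (n : Zd d) : Finset (Zd d) :=
  (Fintype.piFinset fun i => Finset.Icc (n i - 1) (n i + 1)).filter fun m => dist1 n m = 1

/-- A discrete box `∏ [lo i, hi i]`. -/
def dbox {d : ℕ} (lo hi : Zd d) : Finset (Zd d) :=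
  Fintype.piFinset fun i => Finset.Icc (lo i) (hi i)

/-- `n_S(i)`: the number of nearest neighbors of `i` lying outside `S`. -/
def nOut {d : ℕ} (S : Finset (Zd d)) (i : Zd d) : ℕ :=
  ((nbhd i).filter fun j => j ∉ S).card

/-- The matrix of the Neumann Laplacian `h^N_{0,S}` plus a potential `V` on `S`. -/
def neumannMat {d : ℕ} (S : Finset (Zd d)) (V : Zd d → ℝ) : Matrix S S ℝ :=
  fun i j => (if dist1 (i : Zd d) (j : Zd d) = 1 then (-1 : ℝ) else 0)
    + (if i = j then (V (i : Zd d) - (nOut S (i : Zd d) : ℝ)) else 0)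

/-- The pointwise action of `h^N_{0,S} + V` on a function `u : ℤ^d → ℝ` at `i ∈ S`. -/
def napply {d : ℕ} (S : Finset (Zd d)) (V : Zd d → ℝ) (u : Zd d → ℝ) (i : Zd d) : ℝ :=
  (-∑ j ∈ S.filter (fun j => dist1 i j = 1), u j) - (nOut S i : ℝ) * u i + V i * u i

/-- `E_0(a) = min σ(h^N_{0,Λ} + q_a)` for `Λ = ∏ [1, M i]`. -/
def E0 {d : ℕ} (M : Zd d) (q : Zd d → ℝ) (a : Zd d) : ℝ :=
  sInf (spectrum ℝ (neumannMat (dbox (fun _ => 1) M) (fun n => q (n - a))))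

/-- `ℓ²(ℤ^d)` with real coefficients. -/
abbrev l2 (d : ℕ) := lp (fun _ : Zd d => ℝ) 2

/-- The displacement potential `V_ω(n) = ∑_k q(n - kM - ω_k)`. -/
def Vpot {d : ℕ} (M : Zd d) (q : Zd d → ℝ) (ω : Zd d → Zd d) (n : Zd d) : ℝ :=
  ∑' k : Zd d, q (fun i => n i - k i * M i - ω k i)

/-- A displacement configuration is admissible if each `ω_k ∈ Δ = ∏ [0, M i - b i]`. -/
def adm {d : ℕ} (M b : Zd d) (ω : Zd d → Zd d) : Prop :=
  ∀ k i, 0 ≤ ω k i ∧ ω k i ≤ M i - b i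

lemma mem_dbox {d : ℕ} {lo hi x : Zd d} : x ∈ dbox lo hi ↔ ∀ i, lo i ≤ x i ∧ x i ≤ hi i := by
  simp [dbox]

lemma dist1_comm {d : ℕ} (x y : Zd d) : dist1 x y = dist1 y x := by
  simp [dist1, abs_sub_comm]

lemma dist1_self {d : ℕ} (x : Zd d) : dist1 x x = 0 := by
  simp [dist1]

lemma dist1_add_right {d : ℕ} (x y v : Zd d) : dist1 (x + v) (y + v) = dist1 x y := by
  simp [dist1]

lemma abs_sub_le_dist1 {d : ℕ} (x y : Zd d) (i : Fin d) : |x i - y i| ≤ dist1 x y :=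
  Finset.single_le_sum (f := fun i => |x i - y i|) (fun _ _ => abs_nonneg _) (Finset.mem_univ i)

lemma eq_of_dist1_eq_one {d : ℕ} {x y : Zd d} (h : dist1 x y = 1) {i j : Fin d}
    (hi : x i ≠ y i) (hj : j ≠ i) : x j = y j := by
  have h2 : |x i - y i| + |x j - y j| ≤ dist1 x y := by
    rw [← Finset.sum_pair (f := fun k => |x k - y k|) (Ne.symm hj)]
    exact Finset.sum_le_sum_of_subset_of_nonneg (Finset.subset_univ _)
      (fun _ _ _ => abs_nonneg _)
  have h3 : 0 < |x i - y i| := abs_pos.2 (sub_ne_zero.2 hi)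
  have h4 : |x j - y j| = 0 := le_antisymm (by omega) (abs_nonneg _)
  exact sub_eq_zero.1 (abs_eq_zero.1 h4)

lemma mem_nbhd {d : ℕ} {n m : Zd d} : m ∈ nbhd n ↔ dist1 n m = 1 := by
  simp only [nbhd, Finset.mem_filter, Fintype.mem_piFinset, Finset.mem_Icc, and_iff_right_iff_imp]
  intro h i
  have h1 := abs_le.1 ((abs_sub_le_dist1 n m i).trans h.le)
  constructor <;> linarith [h1.1, h1.2]

lemma dist1_update {d : ℕ} (n : Zd d) (l : Fin d) (t : ℤ) :
    dist1 n (Function.update n l t) = |n l - t| := by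
  unfold dist1
  rw [Finset.sum_eq_single l]
  · simp
  · intro j _ hj
    simp [Function.update_of_ne hj]
  · simp

lemma sum_nbhd {d : ℕ} (n : Zd d) (f : Zd d → ℝ) :
    ∑ m ∈ nbhd n, f m
      = ∑ l, (f (Function.update n l (n l + 1)) + f (Function.update n l (n l - 1))) := by
  have hbU : nbhd n = Finset.univ.biUnion
      (fun l => {Function.update n l (n l + 1), Function.update n l (n l - 1)}) := by
    ext m
    simp only [mem_nbhd, Finset.mem_biUnion, Finset.mem_univ, true_and, Finset.mem_insert,
      Finset.mem_singleton]
    constructor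
    · intro h
      have hne : n ≠ m := by
        rintro rfl
        simp [dist1_self] at h
      obtain ⟨l, hl⟩ := Function.ne_iff.1 hne
      refine ⟨l, ?_⟩
      have hm : m = Function.update n l (m l) := by
        ext j
        by_cases hj : j = l
        · subst hj; simp
        · rw [Function.update_of_ne hj]
          exact (eq_of_dist1_eq_one h hl hj).symm
      rw [hm, dist1_update] at h
      rcases (abs_eq (by norm_num)).1 h with h | h
      · right; rw [hm]; congr 1; omega
      · left; rw [hm]; congr 1; omega
    · rintro ⟨l, h | h⟩ <;> rw [h, dist1_update] <;> simp
  have hupd : ∀ (l l' : Fin d) (s t : ℤ), s ≠ n l →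
      Function.update n l s = Function.update n l' t → l = l' := by
    intro l l' s t hs h
    by_contra hne
    have := congrFun h l
    simp [Function.update_of_ne hne] at this
    exact hs this
  rw [hbU, Finset.sum_biUnion]
  · refine Finset.sum_congr rfl fun l _ => ?_
    rw [Finset.sum_pair]
    intro h
    have := congrFun h l
    simp at this
    omega
  · intro l _ l' _ hne
    rw [Function.onFun, Finset.disjoint_left]
    intro m hm hm'
    simp only [Finset.mem_insert, Finset.mem_singleton] at hm hm'
    apply hne
    rcases hm with rfl | rfl <;> rcases hm' with h | h
    · exact hupd _ _ _ _ (by omega) h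
    · exact hupd _ _ _ _ (by omega) h
    · exact hupd _ _ _ _ (by omega) h
    · exact hupd _ _ _ _ (by omega) h

lemma card_nbhd {d : ℕ} (n : Zd d) : ((nbhd n).card : ℝ) = 2 * d := by
  have := sum_nbhd n (fun _ => 1)
  simp only [Finset.sum_const, nsmul_eq_mul, mul_one, Finset.card_univ, Fintype.card_fin] at this
  rw [this]; ring

/-- The Neumann energy on `S` in gradient form, with weight `W` in place of `V - 2d - E`. -/
def energy {d : ℕ} (S : Finset (Zd d)) (W u : Zd d → ℝ) : ℝ :=
  ∑ i ∈ S, W i * u i ^ 2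
    + (1 / 2) * ∑ i ∈ S, ∑ j ∈ S, if dist1 i j = 1 then (u i - u j) ^ 2 else 0

lemma nOut_eq {d : ℕ} (S : Finset (Zd d)) (i : Zd d) :
    (nOut S i : ℝ) = 2 * d - ∑ j ∈ S, if dist1 i j = 1 then (1 : ℝ) else 0 := by
  have h1 := Finset.card_filter_add_card_filter_not (s := nbhd i) (fun j => j ∈ S)
  have h2 : (nbhd i).filter (fun j => j ∈ S) = S.filter (fun j => dist1 i j = 1) := by
    ext j; simp [mem_nbhd, and_comm]
  rw [h2] at h1
  have h3 := card_nbhd i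
  rw [← h1] at h3
  rw [Finset.sum_ite, Finset.sum_const_zero, Finset.sum_const, nsmul_eq_mul, mul_one, nOut]
  push_cast at h3
  linarith

lemma napply_eq {d : ℕ} (S : Finset (Zd d)) (V u : Zd d → ℝ) (i : Zd d) :
    napply S V u i = (V i - 2 * d) * u i
      + ∑ j ∈ S, if dist1 i j = 1 then (u i - u j) else 0 := by
  have h : ∑ j ∈ S, (if dist1 i j = 1 then (u i - u j) else 0)
      = u i * (∑ j ∈ S, if dist1 i j = 1 then (1 : ℝ) else 0)
        - ∑ j ∈ S, (if dist1 i j = 1 then u j else 0) := by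
    rw [Finset.mul_sum, ← Finset.sum_sub_distrib]
    refine Finset.sum_congr rfl fun j _ => ?_
    split_ifs <;> ring
  rw [napply, nOut_eq, Finset.sum_filter, h]
  ring

lemma energy_eq_sum {d : ℕ} (S : Finset (Zd d)) (V u : Zd d → ℝ) (c : ℝ) :
    energy S (fun n => V n - 2 * d - c) u = ∑ i ∈ S, u i * (napply S V u i - c * u i) := by
  have hs : ∑ i ∈ S, ∑ j ∈ S, (if dist1 i j = 1 then u i * (u i - u j) else 0)
      = ∑ i ∈ S, ∑ j ∈ S, (if dist1 i j = 1 then u j * (u j - u i) else 0) := by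
    rw [Finset.sum_comm]
    refine Finset.sum_congr rfl fun i _ => Finset.sum_congr rfl fun j _ => ?_
    rw [dist1_comm]
  have h2 : ∑ i ∈ S, ∑ j ∈ S, (if dist1 i j = 1 then (u i - u j) ^ 2 else 0)
      = ∑ i ∈ S, ∑ j ∈ S, (if dist1 i j = 1 then u i * (u i - u j) else 0)
      + ∑ i ∈ S, ∑ j ∈ S, (if dist1 i j = 1 then u j * (u j - u i) else 0) := by
    simp only [← Finset.sum_add_distrib]
    refine Finset.sum_congr rfl fun i _ => Finset.sum_congr rfl fun j _ => ?_
    split_ifs <;> ring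
  rw [energy, h2, ← hs, ← two_mul, ← mul_assoc, one_div, inv_mul_cancel₀ two_ne_zero, one_mul,
    ← Finset.sum_add_distrib]
  refine Finset.sum_congr rfl fun i _ => ?_
  have h3 : ∑ j ∈ S, (if dist1 i j = 1 then u i * (u i - u j) else 0)
      = u i * ∑ j ∈ S, (if dist1 i j = 1 then (u i - u j) else 0) := by
    rw [Finset.mul_sum]
    refine Finset.sum_congr rfl fun j _ => ?_
    split_ifs <;> ring
  rw [h3, napply_eq]
  ring

lemma energy_shift {d : ℕ} (S : Finset (Zd d)) (V u : Zd d → ℝ) (c c' : ℝ) :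
    energy S (fun n => V n - 2 * d - c) u
      = energy S (fun n => V n - 2 * d - c') u + (c' - c) * ∑ i ∈ S, u i ^ 2 := by
  rw [energy_eq_sum, energy_eq_sum, Finset.mul_sum, ← Finset.sum_add_distrib]
  refine Finset.sum_congr rfl fun i _ => ?_
  ring

lemma energy_congr {d : ℕ} {S : Finset (Zd d)} {W W' u u' : Zd d → ℝ}
    (hW : ∀ i ∈ S, W i = W' i) (hu : ∀ i ∈ S, u i = u' i) : energy S W u = energy S W' u' := by
  unfold energy
  congr 1
  · exact Finset.sum_congr rfl fun i hi => by rw [hW i hi, hu i hi]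
  · congr 1
    exact Finset.sum_congr rfl fun i hi => Finset.sum_congr rfl fun j hj => by
      rw [hu i hi, hu j hj]

lemma sum_sq_pos {d : ℕ} {S : Finset (Zd d)} {u : Zd d → ℝ} (hu : ∃ i ∈ S, u i ≠ 0) :
    0 < ∑ i ∈ S, u i ^ 2 := by
  obtain ⟨i, hi, h⟩ := hu
  exact Finset.sum_pos' (fun _ _ => sq_nonneg _) ⟨i, hi, by positivity⟩

/-- Extension of a function on `S` by zero. -/
def zext {d : ℕ} (S : Finset (Zd d)) (x : S → ℝ) (n : Zd d) : ℝ :=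
  if h : n ∈ S then x ⟨n, h⟩ else 0

lemma zext_coe {d : ℕ} (S : Finset (Zd d)) (x : S → ℝ) (i : S) : zext S x i = x i := by
  simp [zext]

lemma neumannMat_mulVec {d : ℕ} (S : Finset (Zd d)) (V : Zd d → ℝ) (u : Zd d → ℝ) (i : S) :
    (neumannMat S V).mulVec (fun j : S => u j) i = napply S V u i := by
  simp only [Matrix.mulVec, dotProduct, neumannMat, add_mul, Finset.sum_add_distrib, ite_mul,
    zero_mul, Finset.sum_ite_eq, Finset.mem_univ, if_true]
  rw [napply, Finset.sum_filter, ← Finset.sum_neg_distrib,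
    ← Finset.sum_coe_sort S (fun j => -(if dist1 (i : Zd d) j = 1 then u j else 0))]
  have : ∀ j : S, (if dist1 (i : Zd d) j = 1 then (-1 : ℝ) * u j else 0)
      = -(if dist1 (i : Zd d) j = 1 then u j else 0) := by
    intro j; split_ifs <;> simp
  rw [Finset.sum_congr rfl (fun j _ => this j)]
  ring

lemma neumannMat_isHermitian {d : ℕ} (S : Finset (Zd d)) (V : Zd d → ℝ) :
    (neumannMat S V).IsHermitian := by
  ext i j
  simp only [Matrix.conjTranspose_apply, neumannMat, star_trivial, dist1_comm (j : Zd d)]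
  by_cases h : i = j
  · subst h; rfl
  · simp [h, Ne.symm h]

/-- The bottom of the spectrum of the Neumann operator on `S`. -/
def nmin {d : ℕ} (S : Finset (Zd d)) (V : Zd d → ℝ) : ℝ := sInf (spectrum ℝ (neumannMat S V))

lemma exists_eigenvector_nmin {d : ℕ} {S : Finset (Zd d)} (hS : S.Nonempty) (V : Zd d → ℝ) :
    ∃ u : Zd d → ℝ, (∃ i ∈ S, u i ≠ 0) ∧ ∀ i ∈ S, napply S V u i = nmin S V * u i := by
  have hA := neumannMat_isHermitian S V
  have : Nonempty S := hS.to_subtype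
  have hspec := hA.spectrum_real_eq_range_eigenvalues
  have hmem : nmin S V ∈ Set.range hA.eigenvalues := by
    rw [nmin, hspec]
    exact (Set.range_nonempty _).csInf_mem (Set.finite_range _)
  obtain ⟨j, hj⟩ := hmem
  set x : S → ℝ := (hA.eigenvectorBasis j).ofLp with hx
  have hz : (fun k : S => zext S x k) = x := funext (zext_coe S x)
  refine ⟨zext S x, ?_, fun i hi => ?_⟩
  · by_contra! hcon
    have h0 : hA.eigenvectorBasis j = 0 := by
      ext i
      have := hcon i i.2
      rw [zext_coe] at this
      simpa using this
    have := hA.eigenvectorBasis.orthonormal.ne_zero j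
    exact this h0
  · have h1 := neumannMat_mulVec S V (zext S x) ⟨i, hi⟩
    rw [hz, hx, hA.mulVec_eigenvectorBasis j, hj] at h1
    rw [← h1]
    simp only [Pi.smul_apply, smul_eq_mul]
    congr 1
    simp [zext, hi, hx]

lemma dotProduct_mulVec_eq_energy {d : ℕ} (S : Finset (Zd d)) (V : Zd d → ℝ) (c : ℝ)
    (u : Zd d → ℝ) :
    star (fun j : S => u j) ⬝ᵥ (neumannMat S V - c • (1 : Matrix S S ℝ)).mulVec
      (fun j : S => u j) = energy S (fun n => V n - 2 * d - c) u := by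
  rw [energy_eq_sum, ← Finset.sum_coe_sort S]
  simp only [dotProduct]
  refine Finset.sum_congr rfl fun i _ => ?_
  rw [Matrix.sub_mulVec, Pi.sub_apply, neumannMat_mulVec, Matrix.smul_mulVec, Matrix.one_mulVec]
  simp

lemma isHermitian_sub_smul_one {d : ℕ} (S : Finset (Zd d)) (V : Zd d → ℝ) (c : ℝ) :
    (neumannMat S V - c • (1 : Matrix S S ℝ)).IsHermitian := by
  refine (neumannMat_isHermitian S V).sub ?_
  simp [Matrix.IsHermitian]

lemma posSemidef_of_energy_nonneg {d : ℕ} {S : Finset (Zd d)} {V : Zd d → ℝ} {c : ℝ}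
    (h : ∀ u, 0 ≤ energy S (fun n => V n - 2 * d - c) u) :
    (neumannMat S V - c • (1 : Matrix S S ℝ)).PosSemidef := by
  refine Matrix.PosSemidef.of_dotProduct_mulVec_nonneg (isHermitian_sub_smul_one S V c) fun x => ?_
  have := dotProduct_mulVec_eq_energy S V c (zext S x)
  rw [show (fun j : S => zext S x j) = x from funext (zext_coe S x)] at this
  rw [this]
  exact h _

lemma energy_nmin_nonneg {d : ℕ} (S : Finset (Zd d)) (V u : Zd d → ℝ) :
    0 ≤ energy S (fun n => V n - 2 * d - nmin S V) u := by
  have hps : (neumannMat S V - nmin S V • (1 : Matrix S S ℝ)).PosSemidef := by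
    rw [Matrix.posSemidef_iff_isHermitian_and_spectrum_nonneg]
    refine ⟨isHermitian_sub_smul_one S V _, ?_⟩
    rw [← Algebra.algebraMap_eq_smul_one, ← spectrum.sub_singleton_eq]
    rintro _ ⟨a, ha, _, rfl, rfl⟩
    have hfin : (spectrum ℝ (neumannMat S V)).Finite := by
      rw [(neumannMat_isHermitian S V).spectrum_real_eq_range_eigenvalues]
      exact Set.finite_range _
    exact sub_nonneg.2 (csInf_le hfin.bddBelow ha)
  rw [← dotProduct_mulVec_eq_energy]
  exact hps.dotProduct_mulVec_nonneg _

lemma le_nmin {d : ℕ} {S : Finset (Zd d)} (hS : S.Nonempty) {V : Zd d → ℝ} {c : ℝ}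
    (h : ∀ u, 0 ≤ energy S (fun n => V n - 2 * d - c) u) : c ≤ nmin S V := by
  obtain ⟨u, hu, he⟩ := exists_eigenvector_nmin hS V
  have h1 := h u
  have h2 : energy S (fun n => V n - 2 * d - nmin S V) u = 0 := by
    rw [energy_eq_sum]
    exact Finset.sum_eq_zero fun i hi => by rw [he i hi]; ring
  rw [energy_shift S V u c (nmin S V), h2, zero_add] at h1
  by_contra! hc
  nlinarith [sum_sq_pos hu]

lemma energy_nonneg_of_le_nmin {d : ℕ} {S : Finset (Zd d)} {V : Zd d → ℝ} {c : ℝ}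
    (h : c ≤ nmin S V) (u : Zd d → ℝ) : 0 ≤ energy S (fun n => V n - 2 * d - c) u := by
  rw [energy_shift S V u c (nmin S V)]
  have h1 := energy_nmin_nonneg S V u
  have h2 : 0 ≤ ∑ i ∈ S, u i ^ 2 := Finset.sum_nonneg fun _ _ => sq_nonneg _
  have := mul_nonneg (sub_nonneg.2 h) h2
  linarith

lemma nmin_le {d : ℕ} {S : Finset (Zd d)} {V u : Zd d → ℝ} {c : ℝ} (hu : ∃ i ∈ S, u i ≠ 0)
    (h : energy S (fun n => V n - 2 * d - c) u ≤ 0) : nmin S V ≤ c := by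
  have h1 := energy_nmin_nonneg S V u
  rw [energy_shift S V u (nmin S V) c] at h1
  by_contra! hc
  nlinarith [sum_sq_pos hu]

lemma nmin_lt {d : ℕ} {S : Finset (Zd d)} {V u : Zd d → ℝ} {c : ℝ} (hu : ∃ i ∈ S, u i ≠ 0)
    (h : energy S (fun n => V n - 2 * d - c) u < 0) : nmin S V < c := by
  have h1 := energy_nmin_nonneg S V u
  rw [energy_shift S V u (nmin S V) c] at h1
  by_contra! hc
  nlinarith [sum_sq_pos hu]

lemma napply_eq_of_energy_eq_zero {d : ℕ} {S : Finset (Zd d)} {V u : Zd d → ℝ} {c : ℝ}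
    (h : ∀ u, 0 ≤ energy S (fun n => V n - 2 * d - c) u)
    (h0 : energy S (fun n => V n - 2 * d - c) u = 0) :
    ∀ i ∈ S, napply S V u i = c * u i := by
  intro i hi
  rw [← dotProduct_mulVec_eq_energy,
    (posSemidef_of_energy_nonneg h).dotProduct_mulVec_zero_iff] at h0
  have := congrFun h0 ⟨i, hi⟩
  rw [Matrix.sub_mulVec, Pi.sub_apply, neumannMat_mulVec, Matrix.smul_mulVec,
    Matrix.one_mulVec] at this
  simpa [sub_eq_zero] using this

lemma dbox_induction {d : ℕ} {lo hi : Zd d} {p : Zd d → Prop} {x : Zd d} (hx : x ∈ dbox lo hi)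
    (hpx : p x)
    (hstep : ∀ i ∈ dbox lo hi, ∀ j ∈ dbox lo hi, dist1 i j = 1 → p i → p j) :
    ∀ y ∈ dbox lo hi, p y := by
  intro y hy
  obtain ⟨n, hn⟩ : ∃ n : ℕ, dist1 x y = n :=
    Int.eq_ofNat_of_zero_le (Finset.sum_nonneg fun _ _ => abs_nonneg _)
  induction n generalizing y with
  | zero =>
    have : y = x := by
      ext i
      have h1 := abs_sub_le_dist1 x y i
      rw [hn] at h1
      have h2 := abs_nonneg (x i - y i)
      have h3 : |x i - y i| = 0 := le_antisymm (by simpa using h1) h2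
      have := abs_eq_zero.1 h3
      omega
    rwa [this]
  | succ n ih =>
    have hne : x ≠ y := by
      rintro rfl
      rw [dist1_self] at hn
      push_cast at hn
      omega
    obtain ⟨l, hl⟩ := Function.ne_iff.1 hne
    obtain ⟨t, ht1, ht2, ht3⟩ : ∃ t : ℤ, |y l - t| = 1 ∧ |x l - t| + 1 = |x l - y l| ∧
        ((x l ≤ t ∧ t ≤ y l) ∨ (y l ≤ t ∧ t ≤ x l)) := by
      rcases lt_or_gt_of_ne hl with h | h
      · refine ⟨y l - 1, by simp, ?_, Or.inl ⟨by omega, by omega⟩⟩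
        rw [abs_of_nonpos (by omega), abs_of_nonpos (by omega)]; ring
      · refine ⟨y l + 1, by simp, ?_, Or.inr ⟨by omega, by omega⟩⟩
        rw [abs_of_nonneg (by omega), abs_of_nonneg (by omega)]; ring
    have hx' := mem_dbox.1 hx
    have hy' := mem_dbox.1 hy
    have hz : Function.update y l t ∈ dbox lo hi := by
      rw [mem_dbox]
      intro i
      by_cases hi : i = l
      · subst hi
        have := hx' i
        have := hy' i
        simp only [Function.update_self]
        omega
      · rw [Function.update_of_ne hi]
        exact hy' i
    refine hstep _ hz _ hy (by rw [dist1_comm, dist1_update, ht1]) (ih _ hz ?_)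
    have e1 : dist1 x (Function.update y l t) + 1 = dist1 x y := by
      unfold dist1
      rw [← Finset.add_sum_erase _ _ (Finset.mem_univ l),
        ← Finset.add_sum_erase (a := l) _ (fun i => |x i - y i|) (Finset.mem_univ l), ← ht2]
      simp only [Function.update_self]
      have : ∑ i ∈ Finset.univ.erase l, |x i - Function.update y l t i|
          = ∑ i ∈ Finset.univ.erase l, |x i - y i| :=
        Finset.sum_congr rfl fun i hi => by rw [Function.update_of_ne (Finset.ne_of_mem_erase hi)]
      rw [this]; ring
    rw [hn] at e1
    push_cast at e1
    omega

lemma energy_abs_le {d : ℕ} (S : Finset (Zd d)) (W u : Zd d → ℝ) :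
    energy S W (fun n => |u n|) ≤ energy S W u := by
  unfold energy
  simp only [sq_abs]
  gcongr ?_ + _ * ∑ i ∈ S, ∑ j ∈ S, ?_ with i _ j _
  · exact le_rfl
  · split_ifs
    · exact sq_le_sq.2 (abs_abs_sub_abs_le_abs_sub _ _)
    · exact le_rfl

/-- The Neumann operator on a box has a strictly positive ground state. -/
lemma exists_pos_groundState {d : ℕ} {lo hi : Zd d} (h : ∀ i, lo i ≤ hi i) (V : Zd d → ℝ) :
    ∃ u : Zd d → ℝ, (∀ i ∈ dbox lo hi, 0 < u i) ∧
      ∀ i ∈ dbox lo hi, napply (dbox lo hi) V u i = nmin (dbox lo hi) V * u i := by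
  have hne : (dbox lo hi).Nonempty := ⟨lo, mem_dbox.2 fun i => ⟨le_rfl, h i⟩⟩
  obtain ⟨u, ⟨x, hx, hux⟩, he⟩ := exists_eigenvector_nmin hne V
  have h0 : energy (dbox lo hi) (fun n => V n - 2 * d - nmin (dbox lo hi) V) u = 0 := by
    rw [energy_eq_sum]
    exact Finset.sum_eq_zero fun i hi => by rw [he i hi]; ring
  have h1 : energy (dbox lo hi) (fun n => V n - 2 * d - nmin (dbox lo hi) V)
      (fun n => |u n|) = 0 :=
    le_antisymm (h0 ▸ energy_abs_le _ _ _) (energy_nmin_nonneg _ _ _)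
  have he' := napply_eq_of_energy_eq_zero (energy_nmin_nonneg (dbox lo hi) V) h1
  refine ⟨fun n => |u n|, fun i hmem => ?_, he'⟩
  by_contra hcon
  have hi0 : u i = 0 := by simpa using hcon
  have hall := dbox_induction (p := fun n => u n = 0) hmem hi0 (by
    intro i hmem_i j hj hij hui
    have h2 := he' i hmem_i
    rw [napply_eq] at h2
    simp only [hui, abs_zero, mul_zero, zero_sub, zero_add] at h2
    have h3 : ∑ k ∈ dbox lo hi, (if dist1 i k = 1 then |u k| else 0) = 0 := by
      rw [← neg_eq_zero, ← Finset.sum_neg_distrib]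
      refine Eq.trans (Finset.sum_congr rfl fun k _ => ?_) h2
      split_ifs <;> simp
    rw [Finset.sum_eq_zero_iff_of_nonneg (fun k _ => by split_ifs <;> positivity)] at h3
    simpa [hij] using h3 j hj)
  exact hux (hall x hx)

lemma energy_union {d : ℕ} {A B : Finset (Zd d)} (hAB : Disjoint A B) (W u : Zd d → ℝ) :
    energy (A ∪ B) W u = energy A W u + energy B W u
      + ∑ i ∈ A, ∑ j ∈ B, if dist1 i j = 1 then (u i - u j) ^ 2 else 0 := by
  have hs : ∑ i ∈ B, ∑ j ∈ A, (if dist1 i j = 1 then (u i - u j) ^ 2 else 0)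
      = ∑ i ∈ A, ∑ j ∈ B, if dist1 i j = 1 then (u i - u j) ^ 2 else 0 := by
    rw [Finset.sum_comm]
    refine Finset.sum_congr rfl fun i _ => Finset.sum_congr rfl fun j _ => ?_
    rw [dist1_comm, sub_sq_comm]
  unfold energy
  simp only [Finset.sum_union hAB, Finset.sum_add_distrib]
  rw [hs]
  ring

lemma sum_energy_le_energy_biUnion {d : ℕ} {ι : Type*} [DecidableEq ι] (K : Finset ι)
    (T : ι → Finset (Zd d)) (hT : Pairwise fun k l => Disjoint (T k) (T l)) (W u : Zd d → ℝ) :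
    ∑ k ∈ K, energy (T k) W u ≤ energy (K.biUnion T) W u := by
  induction K using Finset.induction_on with
  | empty => simp [energy]
  | insert k K hk ih =>
    rw [Finset.sum_insert hk, Finset.biUnion_insert, energy_union]
    · have : 0 ≤ ∑ i ∈ T k, ∑ j ∈ K.biUnion T,
          (if dist1 i j = 1 then (u i - u j) ^ 2 else 0) :=
        Finset.sum_nonneg fun i _ => Finset.sum_nonneg fun j _ => by split_ifs <;> positivity
      linarith
    · rw [Finset.disjoint_biUnion_right]
      exact fun l hl => hT (by rintro rfl; exact hk hl)

lemma energy_translate {d : ℕ} {S S' : Finset (Zd d)} (v : Zd d)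
    (h : ∀ n, n + v ∈ S ↔ n ∈ S') (W u : Zd d → ℝ) :
    energy S W u = energy S' (fun n => W (n + v)) (fun n => u (n + v)) := by
  have : S = S'.map (Equiv.addRight v).toEmbedding := by
    ext n
    simp only [Finset.mem_map_equiv, ← h]
    simp
  rw [this]
  simp [energy, dist1_add_right]

/-- The `k`-th translate of the box `∏ [1, P i]` under the lattice `∏ P i ℤ`. -/
def tile {d : ℕ} (P k : Zd d) : Finset (Zd d) :=
  dbox (fun i => k i * P i + 1) (fun i => (k i + 1) * P i)

/-- The index of the tile containing a point. -/
def tileIdx {d : ℕ} (P n : Zd d) : Zd d := fun i => (n i - 1) / P i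

lemma mem_tile {d : ℕ} {P : Zd d} (hP : ∀ i, 0 < P i) {k n : Zd d} :
    n ∈ tile P k ↔ tileIdx P n = k := by
  rw [tile, mem_dbox, funext_iff]
  refine forall_congr' fun i => ?_
  rw [tileIdx, Int.ediv_eq_iff_of_pos (hP i), add_mul, one_mul]
  constructor
  · rintro ⟨h1, h2⟩; constructor <;> linarith
  · rintro ⟨h1, h2⟩; constructor <;> linarith

lemma tile_disjoint {d : ℕ} {P : Zd d} (hP : ∀ i, 0 < P i) :
    Pairwise fun k l => Disjoint (tile P k) (tile P l) := by
  intro k l hkl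
  rw [Finset.disjoint_left]
  intro n hk hl
  exact hkl (((mem_tile hP).1 hk).symm.trans ((mem_tile hP).1 hl))

/-- Freeze the `l`-th coordinate of `n` to the interval `[1, m]`. -/
def clampAt {d : ℕ} (l : Fin d) (m : ℤ) (n : Zd d) : Zd d :=
  Function.update n l (max 1 (min m (n l)))

lemma clampAt_eq_self {d : ℕ} {l : Fin d} {m : ℤ} {n : Zd d} (h1 : 1 ≤ n l) (h2 : n l ≤ m) :
    clampAt l m n = n := by
  rw [clampAt, min_eq_right h2, max_eq_right h1, Function.update_eq_self]

lemma clampAt_eq_clampAt {d : ℕ} {l : Fin d} {m : ℤ} {n n' : Zd d} (h : ∀ j ≠ l, n j = n' j)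
    (hl : max 1 (min m (n l)) = max 1 (min m (n' l))) : clampAt l m n = clampAt l m n' := by
  ext j
  by_cases hj : j = l
  · subst hj; simp [clampAt, hl]
  · simp [clampAt, hj, h j hj]

lemma mem_dbox_update {d : ℕ} {lo hi : Zd d} {l : Fin d} {s t : ℤ} {n : Zd d} :
    n ∈ dbox (Function.update lo l s) (Function.update hi l t)
      ↔ (∀ j ≠ l, lo j ≤ n j ∧ n j ≤ hi j) ∧ s ≤ n l ∧ n l ≤ t := by
  rw [mem_dbox]
  constructor
  · intro h
    refine ⟨fun j hj => by simpa [hj] using h j, by simpa using h l⟩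
  · rintro ⟨h1, h2⟩ j
    by_cases hj : j = l
    · subst hj; simpa using h2
    · simpa [hj] using h1 j hj

/-- The slab of the box `∏ [1, M i]` (infinitely extended in direction `l`) where the `l`-th
coordinate lies in `[s, t]`. -/
def slab {d : ℕ} (M : Zd d) (l : Fin d) (s t : ℤ) : Finset (Zd d) :=
  dbox (Function.update (fun _ => 1) l s) (Function.update M l t)

lemma mem_slab {d : ℕ} {M : Zd d} {l : Fin d} {s t : ℤ} {n : Zd d} :
    n ∈ slab M l s t ↔ (∀ j ≠ l, 1 ≤ n j ∧ n j ≤ M j) ∧ s ≤ n l ∧ n l ≤ t :=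
  mem_dbox_update

lemma slab_full {d : ℕ} (M : Zd d) (l : Fin d) : slab M l 1 (M l) = dbox (fun _ => 1) M := by
  simp [slab]

lemma slab_union {d : ℕ} (M : Zd d) (l : Fin d) {s t r : ℤ} (h1 : s ≤ t + 1) (h2 : t ≤ r) :
    slab M l s t ∪ slab M l (t + 1) r = slab M l s r := by
  ext n
  simp only [Finset.mem_union, mem_slab]
  constructor
  · rintro (⟨h, h3, h4⟩ | ⟨h, h3, h4⟩) <;> exact ⟨h, by omega, by omega⟩
  · rintro ⟨h, h3, h4⟩
    by_cases hn : n l ≤ t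
    · exact Or.inl ⟨h, h3, hn⟩
    · exact Or.inr ⟨h, by omega, h4⟩

lemma slab_disjoint {d : ℕ} (M : Zd d) (l : Fin d) (s t r : ℤ) :
    Disjoint (slab M l s t) (slab M l (t + 1) r) := by
  rw [Finset.disjoint_left]
  intro n h1 h2
  rw [mem_slab] at h1 h2
  omega

lemma energy_slab_union {d : ℕ} (M : Zd d) (l : Fin d) {s t r : ℤ} (h1 : s ≤ t + 1) (h2 : t ≤ r)
    (W u : Zd d → ℝ) :
    energy (slab M l s r) W u = energy (slab M l s t) W u + energy (slab M l (t + 1) r) W u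
      + ∑ i ∈ slab M l s t, ∑ j ∈ slab M l (t + 1) r,
          if dist1 i j = 1 then (u i - u j) ^ 2 else 0 := by
  rw [← slab_union M l h1 h2, energy_union (slab_disjoint M l s t r)]

lemma energy_slab_translate {d : ℕ} (M : Zd d) (l : Fin d) (s t v : ℤ) (W u : Zd d → ℝ) :
    energy (slab M l (s + v) (t + v)) W u
      = energy (slab M l s t) (fun n => W (n + Pi.single l v)) (fun n => u (n + Pi.single l v)) := by
  refine energy_translate _ (fun n => ?_) W u
  rw [mem_slab, mem_slab]
  refine and_congr (forall_congr' fun j => imp_congr_right fun hj => ?_) ?_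
  · simp [hj]
  · simp

lemma cross_eq_zero {d : ℕ} (M : Zd d) (l : Fin d) (u : Zd d → ℝ) {s t r m : ℤ}
    (h : max 1 (min m t) = max 1 (min m (t + 1))) :
    ∑ i ∈ slab M l s t, ∑ j ∈ slab M l (t + 1) r,
      (if dist1 i j = 1 then (u (clampAt l m i) - u (clampAt l m j)) ^ 2 else 0) = 0 := by
  refine Finset.sum_eq_zero fun i hi => Finset.sum_eq_zero fun j hj => ?_
  rw [mem_slab] at hi hj
  split_ifs with hij
  · have hne : i l ≠ j l := by omega
    have hle := abs_le.1 ((abs_sub_le_dist1 i j l).trans hij.le)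
    have hil : i l = t := by omega
    have hjl : j l = t + 1 := by omega
    rw [clampAt_eq_clampAt (n := i) (n' := j)
      (fun k hk => eq_of_dist1_eq_one hij hne hk) (by rw [hil, hjl, h])]
    simp
  · rfl

/-- Moving the bubble one step in either direction: the two trial functions obtained by deleting
the layer at one end of the box and duplicating the layer at the other end. -/
lemma energy_slide {d : ℕ} {M b a : Zd d} {q : Zd d → ℝ} (hb : ∀ i, 1 ≤ b i)
    (hsupp : ∀ n, n ∉ dbox (fun _ => 1) b → q n = 0) {l : Fin d} (h0 : 0 < a l)
    (h1 : a l < M l - b l) (u : Zd d → ℝ) (c : ℝ) :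
    energy (dbox (fun _ => 1) M) (fun n => q (n - Function.update a l (a l - 1)) - 2 * d - c)
        (fun n => u (clampAt l (M l) (n + Pi.single l 1)))
      + energy (dbox (fun _ => 1) M) (fun n => q (n - Function.update a l (a l + 1)) - 2 * d - c)
        (fun n => u (clampAt l (M l) (n + Pi.single l (-1))))
      + ∑ i ∈ slab M l 1 1, ∑ j ∈ slab M l 2 (M l),
          (if dist1 i j = 1 then (u i - u j) ^ 2 else 0)
      ≤ 2 * energy (dbox (fun _ => 1) M) (fun n => q (n - a) - 2 * d - c) u := by
  have hbl := hb l
  set W : Zd d → ℝ := fun n => q (n - a) - 2 * d - c with hW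
  set v : Zd d → ℝ := fun n => u (clampAt l (M l) n) with hv
  have hvu : ∀ n ∈ slab M l 1 (M l), v n = u n := by
    intro n hn
    rw [mem_slab] at hn
    simp only [hv]
    rw [clampAt_eq_self hn.2.1 hn.2.2]
  have hq0 : ∀ n : Zd d, (n l ≤ 1 ∨ M l ≤ n l) → q (n - a) = 0 := by
    intro n hn
    apply hsupp
    rw [mem_dbox]
    intro h
    have := h l
    simp only [Pi.sub_apply] at this
    omega
  have e1 : energy (slab M l 1 (M l))
        (fun n => q (n - Function.update a l (a l - 1)) - 2 * d - c)
        (fun n => v (n + Pi.single l 1)) = energy (slab M l 2 (M l + 1)) W v := by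
    rw [show (2 : ℤ) = 1 + 1 by norm_num, energy_slab_translate]
    refine energy_congr (fun n _ => ?_) (fun _ _ => rfl)
    simp only [hW]
    congr 3
    ext j
    by_cases hj : j = l
    · subst hj; simp; ring
    · simp [hj]
  have e2 : energy (slab M l 1 (M l))
        (fun n => q (n - Function.update a l (a l + 1)) - 2 * d - c)
        (fun n => v (n + Pi.single l (-1))) = energy (slab M l 0 (M l - 1)) W v := by
    rw [show (0 : ℤ) = 1 + (-1) by norm_num, sub_eq_add_neg (M l) 1, energy_slab_translate]
    refine energy_congr (fun n _ => ?_) (fun _ _ => rfl)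
    simp only [hW]
    congr 3
    ext j
    by_cases hj : j = l
    · subst hj; simp; ring
    · simp [hj]
  have f1 : energy (slab M l (M l + 1) (M l + 1)) W v = energy (slab M l (M l) (M l)) W v := by
    rw [energy_slab_translate]
    refine energy_congr (fun n hn => ?_) (fun n hn => ?_)
    · rw [mem_slab] at hn
      simp only [hW]
      rw [hq0 n (Or.inr hn.2.1), hq0 _ (Or.inr (by simp; omega))]
    · rw [mem_slab] at hn
      simp only [hv]
      congr 1
      exact clampAt_eq_clampAt (fun j hj => by simp [hj]) (by simp; omega)
  have f2 : energy (slab M l 0 0) W v = energy (slab M l 1 1) W v := by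
    rw [show (0 : ℤ) = 1 + (-1) by norm_num, energy_slab_translate]
    refine energy_congr (fun n hn => ?_) (fun n hn => ?_)
    · rw [mem_slab] at hn
      simp only [hW]
      rw [hq0 n (Or.inl hn.2.2), hq0 _ (Or.inl (by simp; omega))]
    · rw [mem_slab] at hn
      simp only [hv]
      congr 1
      exact clampAt_eq_clampAt (fun j hj => by simp [hj]) (by simp; omega)
  have g1 := energy_slab_union M l (s := 2) (t := M l) (r := M l + 1) (by omega) (by omega) W v
  rw [cross_eq_zero M l u (by omega), f1, add_zero] at g1
  have g2 := energy_slab_union M l (s := 0) (t := 0) (r := M l - 1) (by omega) (by omega) W v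
  rw [cross_eq_zero M l u (by omega), f2, add_zero, zero_add] at g2
  have g3 := energy_slab_union M l (s := 1) (t := 1) (r := M l) (by omega) (by omega) W v
  have g4 := energy_slab_union M l (s := 1) (t := M l - 1) (r := M l) (by omega) (by omega) W v
  rw [sub_add_cancel] at g4
  rw [show (1 : ℤ) + 1 = 2 by norm_num] at g3
  have g5 : 0 ≤ ∑ i ∈ slab M l 1 (M l - 1), ∑ j ∈ slab M l (M l) (M l),
          (if dist1 i j = 1 then (v i - v j) ^ 2 else 0) :=
    Finset.sum_nonneg fun i _ => Finset.sum_nonneg fun j _ => by split_ifs <;> positivity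
  have g6 : energy (slab M l 1 (M l)) W v = energy (slab M l 1 (M l)) W u :=
    energy_congr (fun _ _ => rfl) hvu
  have g7 : ∑ i ∈ slab M l 1 1, ∑ j ∈ slab M l 2 (M l),
          (if dist1 i j = 1 then (u i - u j) ^ 2 else 0)
      = ∑ i ∈ slab M l 1 1, ∑ j ∈ slab M l 2 (M l),
          (if dist1 i j = 1 then (v i - v j) ^ 2 else 0) := by
    refine Finset.sum_congr rfl fun i hi => Finset.sum_congr rfl fun j hj => ?_
    rw [mem_slab] at hi hj
    rw [hvu i (mem_slab.2 ⟨hi.1, by omega, by omega⟩),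
      hvu j (mem_slab.2 ⟨hj.1, by omega, by omega⟩)]
  rw [← slab_full M l, e1, e2, g7]
  linarith

lemma E0_eq_nmin {d : ℕ} (M : Zd d) (q : Zd d → ℝ) (a : Zd d) :
    E0 M q a = nmin (dbox (fun _ => 1) M) (fun n => q (n - a)) := rfl

set_option maxHeartbeats 800000 in
/-- A local minimum of `E0` in a coordinate direction at an interior position is degenerate. -/
lemma E0_interior_min {d : ℕ} {M b a : Zd d} {q : Zd d → ℝ} (hb : ∀ i, 1 ≤ b i)
    (hbM : ∀ i, b i ≤ M i)
    (hsupp : ∀ n, n ∉ dbox (fun _ => 1) b → q n = 0) {l : Fin d} (h0 : 0 < a l)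
    (h1 : a l < M l - b l) (hm : E0 M q a ≤ E0 M q (Function.update a l (a l - 1)))
    (hp : E0 M q a ≤ E0 M q (Function.update a l (a l + 1))) :
    E0 M q a = -(2 * d) ∧ E0 M q (Function.update a l (a l - 1)) = E0 M q a
      ∧ E0 M q (Function.update a l (a l + 1)) = E0 M q a := by
  have hM : ∀ i, 1 ≤ M i := fun i => (hb i).trans (hbM i)
  have hbl := hb l
  obtain ⟨u, hu, he⟩ := exists_pos_groundState (lo := fun _ => 1) hM (fun n => q (n - a))
  rw [← E0_eq_nmin] at he
  set c := E0 M q a with hc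
  have hzero : energy (dbox (fun _ => 1) M) (fun n => q (n - a) - 2 * d - c) u = 0 := by
    rw [energy_eq_sum (V := fun n => q (n - a))]
    exact Finset.sum_eq_zero fun i hi => by rw [he i hi]; ring
  have hs := energy_slide hb hsupp h0 h1 u c
  rw [hzero] at hs
  have hnm := energy_nonneg_of_le_nmin (hm.trans_eq (E0_eq_nmin _ _ _))
    (fun n => u (clampAt l (M l) (n + Pi.single l 1)))
  have hnp := energy_nonneg_of_le_nmin (hp.trans_eq (E0_eq_nmin _ _ _))
    (fun n => u (clampAt l (M l) (n + Pi.single l (-1))))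
  have hX : 0 ≤ ∑ i ∈ slab M l 1 1, ∑ j ∈ slab M l 2 (M l),
          (if dist1 i j = 1 then (u i - u j) ^ 2 else 0) :=
    Finset.sum_nonneg fun i _ => Finset.sum_nonneg fun j _ => by split_ifs <;> positivity
  have hone : (fun _ => 1 : Zd d) ∈ dbox (fun _ => 1) M := mem_dbox.2 fun i => ⟨le_rfl, hM i⟩
  have hclamp : ∀ v : ℤ, clampAt l (M l) ((fun _ => 1 : Zd d) + Pi.single l v)
      ∈ dbox (fun _ => 1) M := by
    intro v
    rw [mem_dbox]
    intro i
    have := hM i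
    by_cases hi : i = l
    · subst hi; simp [clampAt]; omega
    · simp [clampAt, hi]; omega
  refine ⟨?_, le_antisymm ?_ hm, le_antisymm ?_ hp⟩
  · have hX0 : ∑ i ∈ slab M l 1 1, ∑ j ∈ slab M l 2 (M l),
          (if dist1 i j = 1 then (u i - u j) ^ 2 else 0) = 0 := by linarith
    have hadj : ∀ i ∈ slab M l 1 1, ∀ j ∈ slab M l 2 (M l), dist1 i j = 1 → u i = u j := by
      intro i hi j hj hij
      rw [Finset.sum_eq_zero_iff_of_nonneg
        (fun i _ => Finset.sum_nonneg fun j _ => by split_ifs <;> positivity)] at hX0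
      have h2 := hX0 i hi
      rw [Finset.sum_eq_zero_iff_of_nonneg (fun j _ => by split_ifs <;> positivity)] at h2
      have h3 := h2 j hj
      rw [if_pos hij] at h3
      exact sub_eq_zero.1 (pow_eq_zero_iff two_ne_zero |>.1 h3)
    have hsub : ∀ i ∈ slab M l 1 1, i ∈ dbox (fun _ => 1) M := by
      intro i hi
      rw [← slab_full M l, mem_slab]
      rw [mem_slab] at hi
      exact ⟨hi.1, by omega, by omega⟩
    have hsplit : ∀ j ∈ dbox (fun _ => 1) M, j ∈ slab M l 1 1 ∨ j ∈ slab M l 2 (M l) := by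
      intro j hj
      rw [← slab_full M l, ← slab_union M l (t := 1) (by omega) (by omega)] at hj
      exact Finset.mem_union.1 hj
    have hL : (slab M l 1 1).Nonempty :=
      ⟨fun _ => 1, mem_slab.2 ⟨fun j _ => ⟨le_rfl, hM j⟩, le_rfl, le_rfl⟩⟩
    have heq : ∀ i ∈ slab M l 1 1, (c + 2 * d) * u i
        = ∑ j ∈ dbox (fun _ => 1) M, if dist1 i j = 1 then (u i - u j) else 0 := by
      intro i hi
      have h2 := he i (hsub i hi)
      have hq : q (i - a) = 0 := by
        apply hsupp
        rw [mem_dbox]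
        intro h
        have := h l
        rw [mem_slab] at hi
        simp only [Pi.sub_apply] at this
        omega
      rw [napply_eq, hq] at h2
      linarith
    obtain ⟨x, hx, hxmax⟩ := Finset.exists_max_image _ u hL
    obtain ⟨y, hy, hymin⟩ := Finset.exists_min_image _ u hL
    have hcx : 0 ≤ (c + 2 * d) * u x := by
      rw [heq x hx]
      refine Finset.sum_nonneg fun j hj => ?_
      split_ifs with hij
      · rcases hsplit j hj with h | h
        · exact sub_nonneg.2 (hxmax j h)
        · rw [hadj x hx j h hij, sub_self]
      · exact le_rfl
    have hcy : (c + 2 * d) * u y ≤ 0 := by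
      rw [heq y hy]
      refine Finset.sum_nonpos fun j hj => ?_
      split_ifs with hij
      · rcases hsplit j hj with h | h
        · exact sub_nonpos.2 (hymin j h)
        · rw [hadj y hy j h hij, sub_self]
      · exact le_rfl
    have h3 := nonneg_of_mul_nonneg_left hcx (hu x (hsub x hx))
    have h4 := nonpos_of_mul_nonpos_left hcy (hu y (hsub y hy))
    linarith
  · rw [E0_eq_nmin]
    refine nmin_le (u := fun n => u (clampAt l (M l) (n + Pi.single l 1)))
      ⟨_, hone, (hu _ (hclamp 1)).ne'⟩ ?_
    linarith
  · rw [E0_eq_nmin]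
    refine nmin_le (u := fun n => u (clampAt l (M l) (n + Pi.single l (-1))))
      ⟨_, hone, (hu _ (hclamp (-1))).ne'⟩ ?_
    linarith

lemma E0_ne_of_signed {d : ℕ} {M b a : Zd d} {q : Zd d → ℝ} (hb : ∀ i, 1 ≤ b i)
    (hbM : ∀ i, b i ≤ M i) (hsupp : ∀ n, n ∉ dbox (fun _ => 1) b → q n = 0)
    (ha : ∀ i, 0 ≤ a i ∧ a i ≤ M i - b i) (hq : q ≠ 0)
    (hsign : (∀ n, 0 ≤ q n) ∨ (∀ n, q n ≤ 0)) : E0 M q a ≠ -(2 * d) := by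
  have hM : ∀ i, 1 ≤ M i := fun i => (hb i).trans (hbM i)
  obtain ⟨x, hx⟩ := Function.ne_iff.1 hq
  have hxb : x ∈ dbox (fun _ => 1) b := by
    by_contra h
    exact hx (hsupp x h)
  have hxa : x + a ∈ dbox (fun _ => 1) M := by
    rw [mem_dbox] at hxb ⊢
    intro i
    have := hxb i
    have := ha i
    simp only [Pi.add_apply]
    omega
  intro hE
  rcases hsign with hs | hs
  · obtain ⟨u, hu, he⟩ := exists_pos_groundState (lo := fun _ => 1) hM (fun n => q (n - a))
    rw [← E0_eq_nmin, hE] at he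
    have hzero : energy (dbox (fun _ => 1) M) (fun n => q (n - a) - 2 * d - -(2 * d)) u = 0 := by
      rw [energy_eq_sum (V := fun n => q (n - a))]
      exact Finset.sum_eq_zero fun i hi => by rw [he i hi]; ring
    have hpos : 0 < ∑ i ∈ dbox (fun _ => 1) M, (q (i - a) - 2 * d - -(2 * d)) * u i ^ 2 := by
      refine Finset.sum_pos' (fun i _ => ?_) ⟨x + a, hxa, ?_⟩
      · have := mul_nonneg (hs (i - a)) (sq_nonneg (u i))
        linarith
      · have h1 : 0 < q x := lt_of_le_of_ne (hs x) (Ne.symm hx)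
        have h2 := hu _ hxa
        rw [add_sub_cancel_right]
        have : 0 < q x * u (x + a) ^ 2 := by positivity
        linarith
    have hg : 0 ≤ ∑ i ∈ dbox (fun _ => 1) M, ∑ j ∈ dbox (fun _ => 1) M,
        (if dist1 i j = 1 then (u i - u j) ^ 2 else 0) :=
      Finset.sum_nonneg fun i _ => Finset.sum_nonneg fun j _ => by split_ifs <;> positivity
    rw [energy] at hzero
    linarith
  · refine absurd hE (ne_of_lt ?_)
    rw [E0_eq_nmin]
    refine nmin_lt (u := fun _ => 1) ⟨_, hxa, one_ne_zero⟩ ?_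
    simp only [energy, sub_self, one_pow, mul_one, ne_eq, OfNat.ofNat_ne_zero, not_false_eq_true,
      zero_pow, ite_self, Finset.sum_const_zero, mul_zero, add_zero]
    refine Finset.sum_neg' (fun i _ => ?_) ⟨x + a, hxa, ?_⟩
    · linarith [hs (i - a)]
    · rw [add_sub_cancel_right]
      have : q x < 0 := lt_of_le_of_ne (hs x) hx
      linarith

/-- In dimension one an interior minimizer of `E0` forces `E0` to be constantly `-2`. -/
lemma E0_const_of_interior_min {M b a : Zd 1} {q : Zd 1 → ℝ} (hb : ∀ i, 1 ≤ b i)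
    (hbM : ∀ i, b i ≤ M i) (hsupp : ∀ n, n ∉ dbox (fun _ => 1) b → q n = 0)
    (h0 : 0 < a 0) (h1 : a 0 < M 0 - b 0)
    (hmin : ∀ a' : Zd 1, (∀ i, 0 ≤ a' i ∧ a' i ≤ M i - b i) → E0 M q a ≤ E0 M q a')
    (a' : Zd 1) (ha' : ∀ i, 0 ≤ a' i ∧ a' i ≤ M i - b i) : E0 M q a' = -2 := by
  have hupd : ∀ (x : Zd 1) (t : ℤ), Function.update x 0 t = fun _ => t := by
    intro x t; ext i; rw [Subsingleton.elim i 0]; simp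
  have heta : ∀ x : Zd 1, x = fun _ => x 0 := by
    intro x; ext i; rw [Subsingleton.elim i 0]
  have hstep : ∀ t : ℤ, 0 < t → t < M 0 - b 0 → E0 M q (fun _ => t) = E0 M q a →
      E0 M q (fun _ => t) = -2 ∧ E0 M q (fun _ => t - 1) = E0 M q a
        ∧ E0 M q (fun _ => t + 1) = E0 M q a := by
    intro t ht0 ht1 ht
    have hge : ∀ s : ℤ, 0 ≤ s → s ≤ M 0 - b 0 → E0 M q (fun _ => t) ≤ E0 M q (fun _ => s) := by
      intro s hs0 hs1
      rw [ht]
      exact hmin _ fun i => by rw [Subsingleton.elim i 0]; exact ⟨hs0, hs1⟩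
    have := E0_interior_min (a := fun _ => t) hb hbM hsupp (l := 0) ht0 ht1
      (by rw [hupd]; exact hge _ (by omega) (by omega))
      (by rw [hupd]; exact hge _ (by omega) (by omega))
    rw [hupd, hupd, ht] at this
    rw [ht]
    simpa using this
  have hup : ∀ t : ℤ, a 0 ≤ t → t ≤ M 0 - b 0 → E0 M q (fun _ => t) = E0 M q a := by
    intro t ht
    induction t, ht using Int.leInduction with
    | base => intro _; rw [← heta]
    | succ t ht ih =>
      intro h
      exact (hstep t (by omega) (by omega) (ih (by omega))).2.2
  have hdown : ∀ t : ℤ, t ≤ a 0 → 0 ≤ t → E0 M q (fun _ => t) = E0 M q a := by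
    intro t ht
    induction t, ht using Int.leInductionDown with
    | base => intro _; rw [← heta]
    | pred t ht ih =>
      intro h
      exact (hstep t (by omega) (by omega) (ih (by omega))).2.1
  have hval := (hstep (a 0) h0 h1 (by rw [← heta])).1
  rw [← heta] at hval
  rw [← hval, heta a']
  rcases le_total (a 0) (a' 0) with h | h
  · exact hup _ h (ha' 0).2
  · exact hdown _ h (ha' 0).1

/-- Minimizers of `E0` over the admissible positions are corners. -/
lemma corner_of_E0_min {d : ℕ} {M b a : Zd d} {q : Zd d → ℝ} (hb : ∀ i, 1 ≤ b i)
    (hbM : ∀ i, b i ≤ M i) (hsupp : ∀ n, n ∉ dbox (fun _ => 1) b → q n = 0)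
    (hcase : (2 ≤ d ∧ q ≠ 0 ∧ ((∀ n, 0 ≤ q n) ∨ (∀ n, q n ≤ 0)))
      ∨ (d = 1 ∧ ∃ a : Zd d, (∀ i, 0 ≤ a i ∧ a i ≤ M i - b i) ∧ E0 M q a ≠ -2))
    (ha : ∀ i, 0 ≤ a i ∧ a i ≤ M i - b i)
    (hmin : ∀ a' : Zd d, (∀ i, 0 ≤ a' i ∧ a' i ≤ M i - b i) → E0 M q a ≤ E0 M q a')
    (i : Fin d) : a i = 0 ∨ a i = M i - b i := by
  by_contra! hcon
  have hai := ha i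
  have h0 : 0 < a i := by omega
  have h1 : a i < M i - b i := by omega
  rcases hcase with ⟨_, hq, hs⟩ | ⟨rfl, a', ha', hne⟩
  · have hupd : ∀ t : ℤ, 0 ≤ t → t ≤ M i - b i →
        E0 M q a ≤ E0 M q (Function.update a i t) := by
      intro t ht0 ht1
      refine hmin _ fun j => ?_
      by_cases hj : j = i
      · subst hj; simpa using ⟨ht0, ht1⟩
      · simpa [hj] using ha j
    exact E0_ne_of_signed hb hbM hsupp ha hq hs
      (E0_interior_min hb hbM hsupp h0 h1 (hupd _ (by omega) (by omega))
        (hupd _ (by omega) (by omega))).1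
  · rw [Subsingleton.elim i 0] at h0 h1
    exact hne (E0_const_of_interior_min hb hbM hsupp h0 h1 hmin a' ha')

lemma spectrum_bddBelow {E : Type*} [NormedAddCommGroup E] [InnerProductSpace ℝ E]
    [CompleteSpace E] (T : E →L[ℝ] E) : BddBelow (spectrum ℝ T) :=
  (spectrum.isBounded T).bddBelow

lemma le_of_mem_spectrum {E : Type*} [NormedAddCommGroup E] [InnerProductSpace ℝ E]
    [CompleteSpace E] {T : E →L[ℝ] E} {c r : ℝ} (h : ∀ u, c * ‖u‖ ^ 2 ≤ inner ℝ (T u) u)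
    (hr : r ∈ spectrum ℝ T) : c ≤ r := by
  by_contra! hrc
  apply hr
  rw [spectrum.mem_resolventSet_iff, IsUnit.sub_iff]
  refine ContinuousLinearMap.isUnit_of_forall_le_norm_inner_map _
    (c := ⟨c - r, (sub_pos.2 hrc).le⟩) (by exact_mod_cast sub_pos.2 hrc) fun x => ?_
  refine le_trans ?_ (le_abs_self _)
  have h1 := h x
  simp only [sub_apply, inner_sub_left, Algebra.algebraMap_eq_smul_one, smul_apply,
    one_apply_eq_self, inner_smul_left, real_inner_self_eq_norm_sq, conj_trivial]
  change ‖x‖ ^ 2 * (c - r) ≤ _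
  linarith

/-- The infimum of the quadratic form of a bounded symmetric operator lies in its spectrum. -/
lemma isGLB_form_mem_spectrum {E : Type*} [NormedAddCommGroup E] [InnerProductSpace ℝ E]
    {T : E →L[ℝ] E} (hT : ∀ u v, inner ℝ (T u) v = inner ℝ u (T v))
    {m : ℝ} (hm : ∀ u, m * ‖u‖ ^ 2 ≤ inner ℝ (T u) u)
    (hm' : ∀ c, (∀ u, c * ‖u‖ ^ 2 ≤ inner ℝ (T u) u) → c ≤ m) : m ∈ spectrum ℝ T := by
  rw [spectrum.mem_iff, IsUnit.sub_iff]
  rintro ⟨U, hU⟩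
  set A : E →L[ℝ] E := T - algebraMap ℝ _ m with hA
  have hform : ∀ u v, inner ℝ (A u) v = inner ℝ (T u) v - m * inner ℝ u v := by
    intro u v
    simp [hA, inner_sub_left, Algebra.algebraMap_eq_smul_one, inner_smul_left]
  have hpos : ∀ u, 0 ≤ inner ℝ (A u) u := by
    intro u
    rw [hform, real_inner_self_eq_norm_sq]
    linarith [hm u]
  have hsymm : ∀ u v, inner ℝ (A u) v = inner ℝ (A v) u := by
    intro u v
    rw [hform, hform, hT, real_inner_comm u v, real_inner_comm u (T v)]
  have hCS : ∀ u, ‖A u‖ ^ 2 ≤ ‖A‖ * inner ℝ (A u) u := by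
    intro u
    have h1 : ∀ t : ℝ, 0 ≤ inner ℝ (A (A u)) (A u) * (t * t) + 2 * ‖A u‖ ^ 2 * t
        + inner ℝ (A u) u := by
      intro t
      have h2 := hpos (u + t • A u)
      simp only [map_add, map_smul, inner_add_left, inner_add_right, inner_smul_left,
        inner_smul_right, conj_trivial, hsymm (A u) u, real_inner_self_eq_norm_sq] at h2
      linarith
    have h2 := discrim_le_zero h1
    rw [discrim] at h2
    have h3 : inner ℝ (A (A u)) (A u) ≤ ‖A‖ * ‖A u‖ ^ 2 := by
      refine (real_inner_le_norm _ _).trans ?_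
      have := mul_le_mul_of_nonneg_right (A.le_opNorm (A u)) (norm_nonneg (A u))
      linarith
    have h4 := mul_le_mul_of_nonneg_right h3 (hpos u)
    rcases eq_or_lt_of_le (sq_nonneg ‖A u‖) with h5 | h5
    · rw [← h5]
      exact mul_nonneg (norm_nonneg _) (hpos u)
    · refine le_of_mul_le_mul_left ?_ h5
      nlinarith
  set B : E →L[ℝ] E := (↑U⁻¹ : E →L[ℝ] E) with hB
  have hBA : ∀ u, B (A u) = u := by
    intro u
    have : B * A = 1 := by rw [← hU, hB, Units.inv_mul]
    exact congrArg (fun f : E →L[ℝ] E => f u) this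
  set K : ℝ := ‖B‖ ^ 2 * ‖A‖ + 1 with hK
  have hKpos : 0 < K := by positivity
  have hlow : ∀ u, ‖u‖ ^ 2 ≤ K * inner ℝ (A u) u := by
    intro u
    have h1 : ‖u‖ ≤ ‖B‖ * ‖A u‖ := by
      have := B.le_opNorm (A u)
      rwa [hBA] at this
    have h2 : ‖u‖ ^ 2 ≤ ‖B‖ ^ 2 * ‖A u‖ ^ 2 := by
      rw [← mul_pow]
      exact pow_le_pow_left₀ (norm_nonneg _) h1 2
    have h3 := mul_le_mul_of_nonneg_left (hCS u) (sq_nonneg ‖B‖)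
    have := hpos u
    rw [hK]
    nlinarith
  have := hm' (m + K⁻¹) fun u => by
    have h1 := mul_le_mul_of_nonneg_left (hlow u) (inv_pos.2 hKpos).le
    rw [inv_mul_cancel_left₀ hKpos.ne', hform, real_inner_self_eq_norm_sq] at h1
    linarith
  have := inv_pos.2 hKpos
  linarith

/-- The bottom of the spectrum of a bounded symmetric operator is the largest lower bound of its
quadratic form. -/
lemma le_sInf_spectrum_iff {E : Type*} [NormedAddCommGroup E] [InnerProductSpace ℝ E]
    [CompleteSpace E] [Nontrivial E] {T : E →L[ℝ] E}
    (hT : ∀ u v, inner ℝ (T u) v = inner ℝ u (T v)) {c : ℝ} :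
    c ≤ sInf (spectrum ℝ T) ↔ ∀ u, c * ‖u‖ ^ 2 ≤ inner ℝ (T u) u := by
  set F : Set ℝ := {c | ∀ u, c * ‖u‖ ^ 2 ≤ inner ℝ (T u) u} with hF
  have hne : F.Nonempty := by
    refine ⟨-‖T‖, fun u => ?_⟩
    have h1 := (abs_le.1 (abs_real_inner_le_norm (T u) u)).1
    have := mul_le_mul_of_nonneg_right (T.le_opNorm u) (norm_nonneg u)
    linarith
  have hbdd : BddAbove F := by
    obtain ⟨v, hv⟩ := exists_ne (0 : E)
    have hv' : 0 < ‖v‖ ^ 2 := by positivity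
    exact ⟨inner ℝ (T v) v / ‖v‖ ^ 2, fun c hc => (le_div_iff₀ hv').2 (hc v)⟩
  have hmF : sSup F ∈ F := by
    intro u
    rcases eq_or_ne u 0 with rfl | hu
    · simp
    · have hu' : 0 < ‖u‖ ^ 2 := by positivity
      rw [← le_div_iff₀ hu']
      exact csSup_le hne fun c hc => (le_div_iff₀ hu').2 (hc u)
  have hmem := isGLB_form_mem_spectrum hT hmF fun c hc => le_csSup hbdd hc
  constructor
  · intro h u
    refine le_trans (mul_le_mul_of_nonneg_right ?_ (sq_nonneg _)) (hmF u)
    exact h.trans (csInf_le (spectrum_bddBelow T) hmem)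
  · exact fun h => le_csInf ⟨_, hmem⟩ fun r hr => le_of_mem_spectrum h hr

/-- The finitely supported `ℓ²` sequence equal to `f` on `s`. -/
def restrictL2 {d : ℕ} (s : Finset (Zd d)) (f : Zd d → ℝ) : l2 d := ∑ i ∈ s, lp.single 2 i (f i)

lemma restrictL2_apply {d : ℕ} (s : Finset (Zd d)) (f : Zd d → ℝ) (n : Zd d) :
    restrictL2 s f n = if n ∈ s then f n else 0 := by
  rw [restrictL2, lp.coeFn_sum, Finset.sum_apply]
  simp [Pi.single_apply]

lemma inner_restrictL2 {d : ℕ} (s : Finset (Zd d)) (f : Zd d → ℝ) (v : l2 d) :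
    inner ℝ v (restrictL2 s f) = ∑ i ∈ s, f i * v i := by
  simp [restrictL2, inner_sum, lp.inner_single_right]

lemma norm_restrictL2_sq {d : ℕ} (s : Finset (Zd d)) (f : Zd d → ℝ) :
    ‖restrictL2 s f‖ ^ 2 = ∑ i ∈ s, f i ^ 2 := by
  rw [← real_inner_self_eq_norm_sq, inner_restrictL2]
  refine Finset.sum_congr rfl fun i hi => ?_
  rw [restrictL2_apply, if_pos hi, sq]

/-- A lower bound for the form of an operator on finitely supported sequences extends to `ℓ²`. -/
lemma form_bound_of_restrictL2 {d : ℕ} {T : l2 d →L[ℝ] l2 d} {c : ℝ}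
    (h : ∀ s f, c * ‖restrictL2 s f‖ ^ 2 ≤ inner ℝ (T (restrictL2 s f)) (restrictL2 s f))
    (u : l2 d) : c * ‖u‖ ^ 2 ≤ inner ℝ (T u) u := by
  have h1 : Filter.Tendsto (fun s : Finset (Zd d) => restrictL2 s u) Filter.atTop (nhds u) :=
    lp.hasSum_single (by simp) u
  have hc : Continuous fun v : l2 d => inner ℝ (T v) v - c * ‖v‖ ^ 2 := by fun_prop
  have h2 := ge_of_tendsto' ((hc.tendsto u).comp h1) (b := 0) fun s => sub_nonneg.2 (h s u)
  linarith

lemma schrodinger_symm {d : ℕ} {T : l2 d →L[ℝ] l2 d} {V : Zd d → ℝ}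
    (hT : ∀ (u : l2 d) (n : Zd d), (T u) n = (-∑ j ∈ nbhd n, u j) + V n * u n) (u v : l2 d) :
    inner ℝ (T u) v = inner ℝ u (T v) := by
  have hs : ∀ (i : Zd d) (a : ℝ), T (lp.single 2 i a)
      = V i • lp.single 2 i a - restrictL2 (nbhd i) (fun _ => a) := by
    intro i a
    ext n
    rw [hT]
    simp only [lp.single_apply, lp.coeFn_sub, lp.coeFn_smul, Pi.sub_apply, Pi.smul_apply,
      restrictL2_apply, mem_nbhd, Pi.single_apply, Finset.sum_ite_eq', dist1_comm i n, smul_eq_mul]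
    by_cases hn : n = i
    · subst hn; ring
    · simp [hn]
  have h : (innerSL ℝ v).comp T = innerSL ℝ (T v) := by
    refine lp.ext_continuousLinearMap (by simp) fun i => ?_
    ext
    simp [hs, inner_sub_right, inner_restrictL2, inner_smul_right, lp.inner_single_right, hT]
    ring
  have := congrArg (fun f : l2 d →L[ℝ] ℝ => f u) h
  simpa [real_inner_comm] using this

lemma neg_sum_nbhd_eq_napply {d : ℕ} {S : Finset (Zd d)} {V u : Zd d → ℝ}
    (hu : ∀ n ∉ S, u n = 0) (n : Zd d) :
    (-∑ j ∈ nbhd n, u j) + V n * u n = napply S V u n + nOut S n * u n := by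
  have : ∑ j ∈ nbhd n, u j = ∑ j ∈ S.filter (fun j => dist1 n j = 1), u j := by
    symm
    refine Finset.sum_subset (fun j hj => mem_nbhd.2 (Finset.mem_filter.1 hj).2) fun j hj hj' => ?_
    refine hu j fun hS => hj' (Finset.mem_filter.2 ⟨hS, mem_nbhd.1 hj⟩)
  rw [napply, this]
  ring

instance l2_nontrivial (d : ℕ) : Nontrivial (l2 d) := by
  refine ⟨⟨lp.single 2 0 1, 0, fun h => ?_⟩⟩
  have := congrArg (fun f : l2 d => f 0) h
  simp at this

/-- If all Neumann energies on a tiling by boxes are nonnegative after subtracting `c`, then `c`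
bounds the spectrum of the lattice Schrödinger operator from below. -/
lemma le_sInf_spectrum_of_tile {d : ℕ} {T : l2 d →L[ℝ] l2 d} {V : Zd d → ℝ}
    (hT : ∀ (u : l2 d) (n : Zd d), (T u) n = (-∑ j ∈ nbhd n, u j) + V n * u n)
    {P : Zd d} (hP : ∀ i, 0 < P i) {c : ℝ}
    (h : ∀ k u, 0 ≤ energy (tile P k) (fun n => V n - 2 * d - c) u) :
    c ≤ sInf (spectrum ℝ T) := by
  rw [le_sInf_spectrum_iff (schrodinger_symm hT)]
  refine form_bound_of_restrictL2 fun s f => ?_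
  set S := (s.image (tileIdx P)).biUnion (tile P) with hS
  set u : Zd d → ℝ := fun n => if n ∈ s then f n else 0 with hu
  have hsS : s ⊆ S := fun n hn => Finset.mem_biUnion.2
    ⟨tileIdx P n, Finset.mem_image_of_mem _ hn, (mem_tile hP).2 rfl⟩
  have hr : restrictL2 s f = restrictL2 S u := by
    ext n
    rw [restrictL2_apply, restrictL2_apply]
    by_cases hn : n ∈ s
    · simp [hu, hn, hsS hn]
    · simp [hu, hn]
  have hE : 0 ≤ energy S (fun n => V n - 2 * d - c) u :=
    (Finset.sum_nonneg fun k _ => h k u).trans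
      (sum_energy_le_energy_biUnion _ _ (tile_disjoint hP) _ u)
  have hv : ∀ n ∉ S, restrictL2 S u n = 0 := fun n hn => by rw [restrictL2_apply, if_neg hn]
  have hin : ∀ n ∈ S, restrictL2 S u n = u n := fun n hn => by rw [restrictL2_apply, if_pos hn]
  rw [hr, norm_restrictL2_sq, inner_restrictL2, Finset.mul_sum]
  rw [← energy_congr (fun _ _ => rfl) hin, energy_eq_sum] at hE
  rw [← sub_nonneg, ← Finset.sum_sub_distrib]
  refine hE.trans (Finset.sum_le_sum fun n hn => ?_)
  rw [hT, neg_sum_nbhd_eq_napply hv, hin n hn]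
  have : 0 ≤ (nOut S n : ℝ) * u n ^ 2 := by positivity
  linarith

lemma Vpot_eq {d : ℕ} {M b : Zd d} (hM : ∀ i, 0 < M i) {q : Zd d → ℝ}
    (hsupp : ∀ n, n ∉ dbox (fun _ => 1) b → q n = 0) {ω : Zd d → Zd d} (hω : adm M b ω)
    (n : Zd d) :
    Vpot M q ω n = q (fun i => n i - tileIdx M n i * M i - ω (tileIdx M n) i) := by
  refine tsum_eq_single (tileIdx M n) fun k hk => hsupp _ fun h => hk ?_
  rw [mem_dbox] at h
  refine ((mem_tile hM).1 (mem_dbox.2 fun i => ?_)).symm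
  have h1 := h i
  have h2 := hω k i
  constructor <;> linarith

lemma mem_tile_translate {d : ℕ} (P k n : Zd d) :
    (n + fun i => k i * P i) ∈ tile P k ↔ n ∈ dbox (fun _ => 1) P := by
  simp only [tile, mem_dbox, Pi.add_apply, add_mul, one_mul]
  refine forall_congr' fun i => ?_
  constructor <;> rintro ⟨h1, h2⟩ <;> constructor <;> linarith

lemma energy_tile {d : ℕ} {M b : Zd d} (hM : ∀ i, 0 < M i) {q : Zd d → ℝ}
    (hsupp : ∀ n, n ∉ dbox (fun _ => 1) b → q n = 0) {ω : Zd d → Zd d} (hω : adm M b ω)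
    (k : Zd d) (c : ℝ) (u : Zd d → ℝ) :
    energy (tile M k) (fun n => Vpot M q ω n - 2 * d - c) u
      = energy (dbox (fun _ => 1) M) (fun n => q (n - ω k) - 2 * d - c)
        (fun n => u (n + fun i => k i * M i)) := by
  rw [energy_translate (fun i => k i * M i) (mem_tile_translate M k)]
  refine energy_congr (fun n hn => ?_) fun _ _ => rfl
  have h := (mem_tile hM).1 ((mem_tile_translate M k n).2 hn)
  rw [Vpot_eq hM hsupp hω, h]
  congr 3
  ext i
  simp

lemma energy_tile_nonneg {d : ℕ} {M b : Zd d} (hM : ∀ i, 0 < M i) {q : Zd d → ℝ}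
    (hsupp : ∀ n, n ∉ dbox (fun _ => 1) b → q n = 0) {ω : Zd d → Zd d} (hω : adm M b ω)
    {k : Zd d} {c : ℝ} (hc : c ≤ E0 M q (ω k)) (u : Zd d → ℝ) :
    0 ≤ energy (tile M k) (fun n => Vpot M q ω n - 2 * d - c) u := by
  rw [energy_tile hM hsupp hω]
  exact energy_nonneg_of_le_nmin hc _

lemma eq_of_reflections {d : ℕ} {b : Zd d} {q : Zd d → ℝ}
    (hH1 : ∀ (x : Zd d) (i : Fin d), q x = q (Function.update x i (b i - x i + 1)))
    {x y : Zd d} (h : ∀ i, y i = x i ∨ y i = b i - x i + 1) : q x = q y := by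
  have key : ∀ s : Finset (Fin d), q x = q fun i => if i ∈ s then y i else x i := by
    intro s
    induction s using Finset.induction_on with
    | empty => simp
    | insert l s hl ih =>
      rw [ih]
      rcases h l with h | h
      · congr 1
        ext i
        by_cases hi : i = l
        · subst hi; simp [hl, h]
        · simp [hi]
      · rw [hH1 _ l]
        congr 1
        ext i
        by_cases hi : i = l
        · subst hi; simp [hl, h]
        · simp [hi]
  simpa using key Finset.univ

/-- The reflection fold of `ℤ` onto `[1, m]`. -/
def fold (m t : ℤ) : ℤ := if Even ((t - 1) / m) then (t - 1) % m + 1 else m - (t - 1) % m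

lemma fold_eq {m k r : ℤ} (h0 : 0 ≤ r) (h1 : r < m) :
    fold m (m * k + r + 1) = if Even k then r + 1 else m - r := by
  have h2 : (m * k + r) / m = k := by
    rw [Int.add_comm, Int.add_mul_ediv_left _ _ (by omega), Int.ediv_eq_zero_of_lt h0 h1, zero_add]
  have h3 : (m * k + r) % m = r := by
    rw [Int.add_comm, Int.add_mul_emod_self_left, Int.emod_eq_of_lt h0 h1]
  simp only [fold, add_sub_cancel_right, h2, h3]

lemma exists_repr {m : ℤ} (hm : 0 < m) (t : ℤ) :
    ∃ k r, 0 ≤ r ∧ r < m ∧ t = m * k + r + 1 :=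
  ⟨(t - 1) / m, (t - 1) % m, Int.emod_nonneg _ hm.ne', Int.emod_lt_of_pos _ hm, by
    have := Int.mul_ediv_add_emod (t - 1) m
    linarith⟩

lemma fold_mem {m : ℤ} (hm : 0 < m) (t : ℤ) : 1 ≤ fold m t ∧ fold m t ≤ m := by
  obtain ⟨k, r, h0, h1, rfl⟩ := exists_repr hm t
  rw [fold_eq h0 h1]
  split_ifs <;> constructor <;> omega

lemma fold_neighbors {m : ℤ} (hm : 0 < m) (t : ℤ) (g : ℤ → ℝ) :
    g (fold m (t + 1)) + g (fold m (t - 1))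
      = g (min m (fold m t + 1)) + g (max 1 (fold m t - 1)) := by
  obtain ⟨k, r, h0, h1, rfl⟩ := exists_repr hm t
  have hup : fold m (m * k + r + 1 + 1)
      = if Even k then min m (r + 2) else max 1 (m - r - 1) := by
    rcases eq_or_ne (r + 1) m with h | h
    · have : m * k + r + 1 + 1 = m * (k + 1) + 0 + 1 := by linarith
      rw [this, fold_eq le_rfl hm]
      simp only [Int.even_add_one]
      split_ifs <;> omega
    · have : m * k + r + 1 + 1 = m * k + (r + 1) + 1 := by ring
      rw [this, fold_eq (by omega) (by omega)]
      split_ifs <;> omega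
  have hdown : fold m (m * k + r + 1 - 1)
      = if Even k then max 1 r else min m (m - r + 1) := by
    rcases eq_or_ne r 0 with h | h
    · have : m * k + r + 1 - 1 = m * (k - 1) + (m - 1) + 1 := by rw [h]; ring
      rw [this, fold_eq (by omega) (by omega)]
      simp only [Int.even_sub_one]
      split_ifs <;> omega
    · have : m * k + r + 1 - 1 = m * k + (r - 1) + 1 := by ring
      rw [this, fold_eq (by omega) (by omega)]
      split_ifs <;> omega
  rw [hup, hdown, fold_eq h0 h1]
  split_ifs
  · congr 2 <;> congr 1 <;> ring
  · rw [add_comm]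

lemma napply_dbox {d : ℕ} {M i : Zd d} (hi : i ∈ dbox (fun _ => 1) M) (V u : Zd d → ℝ) :
    napply (dbox (fun _ => 1) M) V u i
      = -∑ l, (u (Function.update i l (min (M l) (i l + 1)))
          + u (Function.update i l (max 1 (i l - 1)))) + V i * u i := by
  set S := dbox (fun _ => 1) M with hS
  have h1 : ∑ m ∈ nbhd i, (if m ∈ S then u m else u i)
      = ∑ j ∈ S.filter (fun j => dist1 i j = 1), u j + nOut S i * u i := by
    rw [Finset.sum_ite, Finset.sum_const, nsmul_eq_mul, nOut]
    congr 2
    ext j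
    simp only [Finset.mem_filter, mem_nbhd, and_comm]
  have hmem : ∀ (l : Fin d) (t : ℤ), Function.update i l t ∈ S ↔ 1 ≤ t ∧ t ≤ M l := by
    intro l t
    rw [hS, mem_dbox]
    constructor
    · intro h
      simpa using h l
    · intro h j
      by_cases hj : j = l
      · subst hj; simpa using h
      · simpa [hj] using mem_dbox.1 hi j
  rw [sum_nbhd] at h1
  have h2 : ∀ l, (if Function.update i l (i l + 1) ∈ S then u (Function.update i l (i l + 1))
      else u i) = u (Function.update i l (min (M l) (i l + 1))) := by
    intro l
    have := mem_dbox.1 hi l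
    split_ifs with h
    · rw [min_eq_right ((hmem _ _).1 h).2]
    · rw [hmem] at h
      rw [min_eq_left (by omega), show M l = i l by omega, Function.update_eq_self]
  have h3 : ∀ l, (if Function.update i l (i l - 1) ∈ S then u (Function.update i l (i l - 1))
      else u i) = u (Function.update i l (max 1 (i l - 1))) := by
    intro l
    have := mem_dbox.1 hi l
    split_ifs with h
    · rw [max_eq_right ((hmem _ _).1 h).1]
    · rw [hmem] at h
      rw [max_eq_left (by omega), show (1 : ℤ) = i l by omega, Function.update_eq_self]
  simp only [h2, h3] at h1
  rw [napply, h1]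
  ring

/-- Unfolding an eigenfunction on a box by reflections gives a solution on the whole lattice. -/
lemma unfolded_eigenfunction {d : ℕ} {M : Zd d} (hM : ∀ i, 0 < M i) {V u : Zd d → ℝ} {c : ℝ}
    (h : ∀ i ∈ dbox (fun _ => 1) M, napply (dbox (fun _ => 1) M) V u i = c * u i) (n : Zd d) :
    (-∑ m ∈ nbhd n, u (fun i => fold (M i) (m i))) + V (fun i => fold (M i) (n i))
      * u (fun i => fold (M i) (n i)) = c * u (fun i => fold (M i) (n i)) := by
  have hF : (fun i => fold (M i) (n i)) ∈ dbox (fun _ => 1) M :=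
    mem_dbox.2 fun i => fold_mem (hM i) _
  rw [← h _ hF, napply_dbox hF, sum_nbhd]
  have hup : ∀ (l : Fin d) (t : ℤ), (fun i => fold (M i) (Function.update n l t i))
      = Function.update (fun i => fold (M i) (n i)) l (fold (M l) t) := by
    intro l t
    ext i
    by_cases hi : i = l
    · subst hi; simp
    · simp [hi]
  simp only [hup]
  congr 2
  exact Finset.sum_congr rfl fun l _ => fold_neighbors (hM l) (n l)
    fun t => u (Function.update (fun i => fold (M i) (n i)) l t)

/-- The configuration obtained from a single position by reflecting in the tile walls. -/
def reflConfig {d : ℕ} (M b a k : Zd d) : Zd d :=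
  fun i => if Even (k i) then a i else M i - b i - a i

lemma adm_reflConfig {d : ℕ} {M b a : Zd d} (ha : ∀ i, 0 ≤ a i ∧ a i ≤ M i - b i) :
    adm M b (reflConfig M b a) := by
  intro k i
  have := ha i
  unfold reflConfig
  split_ifs <;> constructor <;> omega

lemma Vpot_reflConfig {d : ℕ} {M b a : Zd d} (hM : ∀ i, 0 < M i) {q : Zd d → ℝ}
    (hsupp : ∀ n, n ∉ dbox (fun _ => 1) b → q n = 0)
    (hH1 : ∀ (x : Zd d) (i : Fin d), q x = q (Function.update x i (b i - x i + 1)))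
    (ha : ∀ i, 0 ≤ a i ∧ a i ≤ M i - b i) (n : Zd d) :
    Vpot M q (reflConfig M b a) n = q ((fun i => fold (M i) (n i)) - a) := by
  rw [Vpot_eq hM hsupp (adm_reflConfig ha)]
  refine eq_of_reflections hH1 fun i => ?_
  have h : M i * tileIdx M n i + (n i - 1) % M i = n i - 1 :=
    Int.mul_ediv_add_emod (n i - 1) (M i)
  have hf : fold (M i) (n i)
      = if Even (tileIdx M n i) then (n i - 1) % M i + 1 else M i - (n i - 1) % M i := rfl
  by_cases hk : Even (tileIdx M n i)
  · left
    simp only [Pi.sub_apply, hf, reflConfig, if_pos hk]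
    linarith
  · right
    simp only [Pi.sub_apply, hf, reflConfig, if_neg hk]
    linarith

lemma abs_norm_sub_le_of_mem_nbhd {d : ℕ} {n m : Zd d} (h : m ∈ nbhd n) : |‖n‖ - ‖m‖| ≤ 1 := by
  refine (abs_norm_sub_norm_le n m).trans ((pi_norm_le_iff_of_nonneg zero_le_one).2 fun i => ?_)
  have := abs_sub_le_dist1 n m i
  rw [mem_nbhd.1 h] at this
  rw [Int.norm_eq_abs]
  exact_mod_cast this

lemma norm_le_iff_mem_dbox {d : ℕ} {n : Zd d} (R : ℕ) :
    ‖n‖ ≤ R ↔ n ∈ dbox (fun _ => -(R : ℤ)) (fun _ => R) := by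
  rw [pi_norm_le_iff_of_nonneg (Nat.cast_nonneg R), mem_dbox]
  refine forall_congr' fun i => ?_
  rw [Int.norm_eq_abs, ← abs_le]
  exact_mod_cast Iff.rfl

lemma card_dbox_symm (d R : ℕ) :
    ((dbox (d := d) (fun _ => -(R : ℤ)) (fun _ => R)).card : ℝ) = (2 * R + 1) ^ d := by
  rw [dbox, Fintype.card_piFinset_const, Int.card_Icc]
  have : ((R : ℤ) + 1 - -(R : ℤ)).toNat = 2 * R + 1 := by omega
  rw [this]
  push_cast
  ring

/-- A solution of the eigenvalue equation on the whole lattice that is bounded above and away from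
zero bounds the bottom of the spectrum from above. -/
lemma sInf_spectrum_le_of_bounded_solution {d : ℕ} {T : l2 d →L[ℝ] l2 d} {V U : Zd d → ℝ}
    (hT : ∀ (u : l2 d) (n : Zd d), (T u) n = (-∑ j ∈ nbhd n, u j) + V n * u n) {c₀ C E : ℝ}
    (hc₀ : 0 < c₀) (hU : ∀ n, c₀ ≤ U n) (hC : ∀ n, U n ≤ C)
    (hE : ∀ n, (-∑ m ∈ nbhd n, U m) + V n * U n = E * U n) : sInf (spectrum ℝ T) ≤ E := by
  have hform := (le_sInf_spectrum_iff (schrodinger_symm hT)).1 le_rfl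
  set lam := sInf (spectrum ℝ T)
  by_contra! hlt
  have key : ∀ R : ℕ, 0 < R → (lam - E) * c₀ ^ 2 * R ≤ 4 * d * C ^ 2 * 2 ^ d := by
    intro R hR
    have hR' : (0 : ℝ) < R := by exact_mod_cast hR
    set φ : Zd d → ℝ := fun n => max 0 (2 * R - ‖n‖) with hφ
    have hφ0 : ∀ n, 0 ≤ φ n := fun n => le_max_left _ _
    have hφlip : ∀ n, ∀ m ∈ nbhd n, |φ n - φ m| ≤ 1 := by
      intro n m hm
      have h1 := abs_max_sub_max_le_abs (2 * (R : ℝ) - ‖n‖) (2 * R - ‖m‖) 0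
      rw [sub_sub_sub_cancel_left, abs_sub_comm ‖m‖] at h1
      simp only [hφ, max_comm (0 : ℝ)]
      exact h1.trans (abs_norm_sub_le_of_mem_nbhd hm)
    set S := dbox (d := d) (fun _ => -((2 * R : ℕ) : ℤ)) (fun _ => (2 * R : ℕ)) with hS
    set S' := dbox (d := d) (fun _ => -(R : ℤ)) (fun _ => R) with hS'
    have hS'S : S' ⊆ S := by
      intro n hn
      rw [hS', ← norm_le_iff_mem_dbox] at hn
      rw [hS, ← norm_le_iff_mem_dbox]
      push_cast
      linarith
    have hφS : ∀ n ∉ S, φ n = 0 := by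
      intro n hn
      rw [hS, ← norm_le_iff_mem_dbox] at hn
      push_cast at hn
      exact max_eq_left (by linarith)
    set f : l2 d := restrictL2 S (fun n => U n * φ n) with hf
    have hfn : ∀ n, f n = U n * φ n := by
      intro n
      rw [hf, restrictL2_apply]
      split_ifs with h
      · rfl
      · rw [hφS n h, mul_zero]
    have hterm : ∀ n, U n * φ n * (T f) n - E * (U n * φ n) ^ 2 ≤ 2 * d * C ^ 2 * φ n := by
      intro n
      have h1 : U n * φ n * (T f) n - E * (U n * φ n) ^ 2
          = ∑ m ∈ nbhd n, φ n * (U n * U m * (φ n - φ m)) := by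
        have h2 : ∑ m ∈ nbhd n, φ n * (U n * U m * (φ n - φ m))
            = φ n ^ 2 * U n * (∑ m ∈ nbhd n, U m) - φ n * U n * ∑ m ∈ nbhd n, U m * φ m := by
          rw [Finset.mul_sum, Finset.mul_sum, ← Finset.sum_sub_distrib]
          exact Finset.sum_congr rfl fun m _ => by ring
        rw [h2, hT]
        simp only [hfn]
        linear_combination U n * φ n ^ 2 * hE n
      rw [h1, ← card_nbhd n]
      have h3 : ∀ m ∈ nbhd n, φ n * (U n * U m * (φ n - φ m)) ≤ C ^ 2 * φ n := by
        intro m hm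
        have hn0 := hc₀.le.trans (hU n)
        have hm0 := hc₀.le.trans (hU m)
        have h4 : U n * U m ≤ C ^ 2 := by
          rw [sq]
          exact mul_le_mul (hC n) (hC m) hm0 (hn0.trans (hC n))
        have h5 : U n * U m * (φ n - φ m) ≤ C ^ 2 :=
          (mul_le_of_le_one_right (mul_nonneg hn0 hm0) (abs_le.1 (hφlip n m hm)).2).trans h4
        rw [mul_comm]
        exact mul_le_mul_of_nonneg_right h5 (hφ0 n)
      refine (Finset.sum_le_card_nsmul _ _ _ h3).trans_eq ?_
      rw [nsmul_eq_mul, mul_assoc]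
    have hlow := hform f
    rw [hf, norm_restrictL2_sq, inner_restrictL2, ← hf] at hlow
    have hup : ∑ n ∈ S, U n * φ n * (T f) n - E * ∑ n ∈ S, (U n * φ n) ^ 2
        ≤ 2 * d * C ^ 2 * (2 * R * (4 * R + 1) ^ d) := by
      rw [Finset.mul_sum, ← Finset.sum_sub_distrib]
      refine (Finset.sum_le_sum fun n _ => hterm n).trans ?_
      rw [← Finset.mul_sum]
      refine mul_le_mul_of_nonneg_left ?_ (by positivity)
      have h6 : ∀ n ∈ S, φ n ≤ 2 * R := fun n _ => max_le (by positivity) (by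
        have := norm_nonneg n
        linarith)
      refine (Finset.sum_le_card_nsmul _ _ _ h6).trans_eq ?_
      rw [nsmul_eq_mul, hS, card_dbox_symm]
      push_cast
      ring
    have hnorm : c₀ ^ 2 * R ^ 2 * (2 * R + 1) ^ d ≤ ∑ n ∈ S, (U n * φ n) ^ 2 := by
      refine le_trans ?_ (Finset.sum_le_sum_of_subset_of_nonneg hS'S fun _ _ _ => sq_nonneg _)
      have h7 : ∀ n ∈ S', c₀ ^ 2 * (R : ℝ) ^ 2 ≤ (U n * φ n) ^ 2 := by
        intro n hn
        rw [hS', ← norm_le_iff_mem_dbox] at hn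
        rw [← mul_pow]
        refine pow_le_pow_left₀ (by positivity) (mul_le_mul (hU n) ?_ hR'.le
          (hc₀.le.trans (hU n))) 2
        exact le_max_of_le_right (by linarith)
      refine le_trans (le_of_eq ?_) (Finset.card_nsmul_le_sum _ _ _ h7)
      rw [nsmul_eq_mul, hS', card_dbox_symm]
      ring
    have h8 : ((4 : ℝ) * R + 1) ^ d ≤ 2 ^ d * (2 * R + 1) ^ d := by
      rw [← mul_pow]
      exact pow_le_pow_left₀ (by positivity) (by linarith) d
    have h9 : (lam - E) * (c₀ ^ 2 * R ^ 2 * (2 * R + 1) ^ d)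
        ≤ 2 * d * C ^ 2 * (2 * R * (2 ^ d * (2 * R + 1) ^ d)) :=
      calc _ ≤ (lam - E) * ∑ n ∈ S, (U n * φ n) ^ 2 :=
            mul_le_mul_of_nonneg_left hnorm (sub_pos.2 hlt).le
        _ ≤ 2 * d * C ^ 2 * (2 * R * (4 * R + 1) ^ d) := by linarith
        _ ≤ _ := by gcongr
    have hpos : (0 : ℝ) < R * (2 * R + 1) ^ d := by positivity
    refine le_of_mul_le_mul_right ?_ hpos
    linarith
  have hpos : 0 < (lam - E) * c₀ ^ 2 := mul_pos (sub_pos.2 hlt) (by positivity)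
  obtain ⟨R, hR⟩ := exists_nat_gt (4 * d * C ^ 2 * 2 ^ d / ((lam - E) * c₀ ^ 2))
  rw [div_lt_iff₀ hpos] at hR
  have h := key (R + 1) R.succ_pos
  push_cast at h
  linarith

/-- The reflected configuration attains the Neumann ground state energy of a single tile. -/
lemma sInf_spectrum_reflConfig_le {d : ℕ} {M b a : Zd d} (hM : ∀ i, 0 < M i) {q : Zd d → ℝ}
    (hsupp : ∀ n, n ∉ dbox (fun _ => 1) b → q n = 0)
    (hH1 : ∀ (x : Zd d) (i : Fin d), q x = q (Function.update x i (b i - x i + 1)))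
    (ha : ∀ i, 0 ≤ a i ∧ a i ≤ M i - b i) {T : l2 d →L[ℝ] l2 d}
    (hT : ∀ (u : l2 d) (n : Zd d),
      (T u) n = (-∑ j ∈ nbhd n, u j) + Vpot M q (reflConfig M b a) n * u n) :
    sInf (spectrum ℝ T) ≤ E0 M q a := by
  obtain ⟨u, hu, he⟩ := exists_pos_groundState (lo := fun _ => 1) (hi := M) (fun i => hM i)
    (fun n => q (n - a))
  have hne : (dbox (fun _ => 1) M).Nonempty := ⟨M, mem_dbox.2 fun i => ⟨hM i, le_rfl⟩⟩
  obtain ⟨x, hx, hxmin⟩ := Finset.exists_min_image _ u hne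
  obtain ⟨y, hy, hymax⟩ := Finset.exists_max_image _ u hne
  have hF : ∀ n : Zd d, (fun i => fold (M i) (n i)) ∈ dbox (fun _ => 1) M := fun n =>
    mem_dbox.2 fun i => fold_mem (hM i) _
  refine sInf_spectrum_le_of_bounded_solution hT (U := fun n => u fun i => fold (M i) (n i))
    (hu x hx) (fun n => hxmin _ (hF n)) (fun n => hymax _ (hF n)) fun n => ?_
  rw [Vpot_reflConfig hM hsupp hH1 ha]
  exact unfolded_eigenfunction hM he n

lemma dbox_eq_biUnion_tile {d : ℕ} {M : Zd d} (hM : ∀ i, 0 < M i) (L : Zd d) :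
    dbox (fun _ => 1) (fun i => L i * M i) = (dbox 0 (fun i => L i - 1)).biUnion (tile M) := by
  ext n
  simp only [Finset.mem_biUnion, mem_tile hM, exists_eq_right', mem_dbox, tileIdx, Pi.zero_apply]
  refine forall_congr' fun i => and_congr ?_ ?_
  · rw [Int.ediv_nonneg_iff_of_pos (hM i)]
    omega
  · rw [Int.le_sub_one_iff, Int.ediv_lt_iff_lt_mul (hM i)]
    omega

lemma Vpot_periodic {d : ℕ} {M b : Zd d} (hM : ∀ i, 0 < M i) {q : Zd d → ℝ}
    (hsupp : ∀ n, n ∉ dbox (fun _ => 1) b → q n = 0) {ω : Zd d → Zd d} (hω : adm M b ω)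
    {L : Fin d → ℤ} (hper : ∀ i n : Zd d, ω (fun j => i j + n j * L j) = ω i) (n k : Zd d) :
    Vpot M q ω (n + fun i => k i * (L i * M i)) = Vpot M q ω n := by
  have hidx : tileIdx M (n + fun i => k i * (L i * M i)) = fun i => tileIdx M n i + k i * L i := by
    ext i
    rw [tileIdx, tileIdx, Pi.add_apply, ← Int.add_mul_ediv_right _ _ (hM i).ne']
    congr 1
    ring
  rw [Vpot_eq hM hsupp hω, Vpot_eq hM hsupp hω, hidx, hper]
  congr 1
  ext i
  simp only [Pi.add_apply]
  ring

lemma exists_E0_min {d : ℕ} {M b : Zd d} (hbM : ∀ i, b i ≤ M i) (q : Zd d → ℝ) :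
    ∃ a : Zd d, (∀ i, 0 ≤ a i ∧ a i ≤ M i - b i) ∧
      ∀ a' : Zd d, (∀ i, 0 ≤ a' i ∧ a' i ≤ M i - b i) → E0 M q a ≤ E0 M q a' := by
  have hne : (dbox 0 (M - b)).Nonempty :=
    ⟨0, mem_dbox.2 fun i => ⟨le_rfl, by simpa using hbM i⟩⟩
  obtain ⟨a, ha, hmin⟩ := Finset.exists_min_image _ (E0 M q) hne
  exact ⟨a, mem_dbox.1 ha, fun a' ha' => hmin a' (mem_dbox.2 ha')⟩

/-- **Periodic spectral minimizers sit in the corners.**  Assume (H1) and the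
hypotheses guaranteeing that `E_0` is strictly minimized at the corners of `Δ`.  If
`ω` is an `L`-periodic admissible configuration with `min σ(h_ω) = E_min`, then:
(1) every `ω_k` is a corner of `Δ`; (2) `E_min = min σ(h^N_{0,Λ̲} + V_ω|_Λ̲)` for the
period cell `Λ̲ = ∏ [1, L_i M_i]`; (3) the restriction of any positive Neumann ground
state `ψ` on `Λ̲` (with eigenvalue `E_min`) to each translate `Λ_k = Λ + (k-1)M`
(`k ∈ ∏ [1, L_i]`) is a ground state of `h^N_{0,Λ_k} + V_ω|_{Λ_k}` with eigenvalue
`E_min`. -/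
theorem periodic_minimizers_sit_in_corners
    (d : ℕ) (hd : 1 ≤ d) (M b : Zd d)
    (hb : ∀ i, 1 ≤ b i) (hbM : ∀ i, b i ≤ M i)
    (q : Zd d → ℝ)
    (hsupp : ∀ n, n ∉ dbox (fun _ => 1) b → q n = 0)
    (hH1 : ∀ (x : Zd d) (i : Fin d), q x = q (Function.update x i (b i - x i + 1)))
    (hcase : (2 ≤ d ∧ q ≠ 0 ∧ ((∀ n, 0 ≤ q n) ∨ (∀ n, q n ≤ 0)))
      ∨ (d = 1 ∧ ∃ a : Zd d, (∀ i, 0 ≤ a i ∧ a i ≤ M i - b i) ∧ E0 M q a ≠ -2))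
    (H : (Zd d → Zd d) → (l2 d →L[ℝ] l2 d))
    (hH : ∀ ω, adm M b ω → ∀ (u : l2 d) (n : Zd d),
      (H ω u) n = (-∑ j ∈ nbhd n, u j) + Vpot M q ω n * u n)
    (Emin : ℝ)
    (hEmin : Emin = sInf ((fun ω => sInf (spectrum ℝ (H ω))) '' {ω | adm M b ω}))
    (Lvec : Fin d → ℤ) (hLvec : ∀ i, 0 < Lvec i)
    (ω : Zd d → Zd d) (hadm : adm M b ω)
    (hper : ∀ i n : Zd d, ω (fun j => i j + n j * Lvec j) = ω i)
    (hmin : sInf (spectrum ℝ (H ω)) = Emin) :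
    (∀ k i, ω k i = 0 ∨ ω k i = M i - b i)
    ∧ sInf (spectrum ℝ (neumannMat (dbox (fun _ => 1) (fun i => Lvec i * M i))
        (Vpot M q ω))) = Emin
    ∧ ∀ ψ : Zd d → ℝ,
        (∀ i ∈ dbox (fun _ => 1) (fun i => Lvec i * M i), 0 < ψ i) →
        (∀ i ∈ dbox (fun _ => 1) (fun i => Lvec i * M i),
          napply (dbox (fun _ => 1) (fun i => Lvec i * M i)) (Vpot M q ω) ψ i
            = Emin * ψ i) →
        ∀ k ∈ dbox (fun _ => 1) Lvec,
          (∀ i ∈ dbox (fun j => (k j - 1) * M j + 1) (fun j => k j * M j),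
            napply (dbox (fun j => (k j - 1) * M j + 1) (fun j => k j * M j))
              (Vpot M q ω) ψ i = Emin * ψ i)
          ∧ sInf (spectrum ℝ (neumannMat
              (dbox (fun j => (k j - 1) * M j + 1) (fun j => k j * M j))
              (Vpot M q ω))) = Emin := by
  have hM : ∀ i, 0 < M i := fun i => by linarith [hb i, hbM i]
  have hP : ∀ i, 0 < Lvec i * M i := fun i => mul_pos (hLvec i) (hM i)
  obtain ⟨a, ha, hamin⟩ := exists_E0_min hbM q
  have hlow : ∀ ω', adm M b ω' → E0 M q a ≤ sInf (spectrum ℝ (H ω')) := fun ω' hω' =>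
    le_sInf_spectrum_of_tile (hH ω' hω') hM fun k u =>
      energy_tile_nonneg hM hsupp hω' (hamin _ (hω' k)) u
  have hupp : Emin ≤ E0 M q a := by
    have hrefl := adm_reflConfig ha
    rw [hEmin]
    refine (csInf_le ⟨E0 M q a, ?_⟩ (Set.mem_image_of_mem _ hrefl)).trans
      (sInf_spectrum_reflConfig_le hM hsupp hH1 ha (hH _ hrefl))
    rintro _ ⟨ω', hω', rfl⟩
    exact hlow ω' hω'
  have hE : E0 M q a = Emin := le_antisymm (hmin ▸ hlow ω hadm) hupp
  have htile : ∀ k u, 0 ≤ energy (tile M k) (fun n => Vpot M q ω n - 2 * d - Emin) u :=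
    fun k u => energy_tile_nonneg hM hsupp hadm (hE ▸ hamin _ (hadm k)) u
  set K : Finset (Zd d) := dbox 0 (fun i => Lvec i - 1) with hK
  set S : Finset (Zd d) := dbox (fun _ => 1) (fun i => Lvec i * M i) with hS
  have hSne : S.Nonempty := ⟨fun _ => 1, mem_dbox.2 fun i => ⟨le_rfl, hP i⟩⟩
  have hsum : ∀ u, ∑ k ∈ K, energy (tile M k) (fun n => Vpot M q ω n - 2 * d - Emin) u
      ≤ energy S (fun n => Vpot M q ω n - 2 * d - Emin) u := by
    intro u
    rw [hS, dbox_eq_biUnion_tile hM]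
    exact sum_energy_le_energy_biUnion _ _ (tile_disjoint hM) _ u
  have hcell : nmin S (Vpot M q ω) = Emin := by
    refine le_antisymm ?_ (le_nmin hSne fun u =>
      (Finset.sum_nonneg fun k _ => htile k u).trans (hsum u))
    rw [← hmin]
    refine le_sInf_spectrum_of_tile (hH ω hadm) hP fun k u => ?_
    rw [energy_translate _ (mem_tile_translate _ k)]
    simp only [Vpot_periodic hM hsupp hadm hper]
    exact energy_nmin_nonneg _ _ _
  have hzero : ∀ ψ : Zd d → ℝ, (∀ i ∈ S, napply S (Vpot M q ω) ψ i = Emin * ψ i) →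
      ∀ k ∈ K, energy (tile M k) (fun n => Vpot M q ω n - 2 * d - Emin) ψ = 0 := by
    intro ψ hψ
    rw [← Finset.sum_eq_zero_iff_of_nonneg fun k _ => htile k ψ]
    refine le_antisymm ((hsum ψ).trans_eq ?_) (Finset.sum_nonneg fun k _ => htile k ψ)
    rw [energy_eq_sum]
    exact Finset.sum_eq_zero fun i hi => by rw [hψ i hi, sub_self, mul_zero]
  have htileS : ∀ k ∈ K, tile M k ⊆ S := by
    intro k hk
    rw [hS, dbox_eq_biUnion_tile hM]
    exact Finset.subset_biUnion_of_mem _ hk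
  have htile_ne : ∀ k, (fun i => 1 + k i * M i) ∈ tile M k := fun k =>
    (mem_tile_translate M k fun _ => 1).2 (mem_dbox.2 fun i => ⟨le_rfl, by linarith [hM i]⟩)
  refine ⟨?_, hcell, ?_⟩
  · obtain ⟨ψ, hψpos, hψ⟩ := exists_pos_groundState (lo := fun _ => 1)
      (hi := fun i => Lvec i * M i) (fun i => hP i) (Vpot M q ω)
    rw [← hS] at hψpos hψ
    rw [hcell] at hψ
    have hcorner : ∀ k ∈ K, ∀ i, ω k i = 0 ∨ ω k i = M i - b i := by
      intro k hk
      refine corner_of_E0_min hb hbM hsupp hcase (hadm k) fun a' ha' => ?_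
      refine le_trans ?_ (hamin a' ha')
      rw [hE, E0_eq_nmin]
      have h0 := hzero ψ hψ k hk
      rw [energy_tile hM hsupp hadm] at h0
      exact nmin_le ⟨fun _ => 1, mem_dbox.2 fun i => ⟨le_rfl, hM i⟩,
        (hψpos _ (htileS k hk (htile_ne k))).ne'⟩ h0.le
    intro k
    have hk : (fun i => k i % Lvec i) ∈ K := mem_dbox.2 fun i =>
      ⟨Int.emod_nonneg _ (hLvec i).ne', by have := Int.emod_lt_of_pos (k i) (hLvec i); omega⟩
    have := hper (fun i => k i % Lvec i) (fun i => k i / Lvec i)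
    simp only [Int.emod_add_ediv_mul] at this
    rw [show ω k = _ from this]
    exact hcorner _ hk
  · intro ψ hψpos hψ k hk
    have hkK : (fun j => k j - 1) ∈ K := mem_dbox.2 fun j => by
      have := mem_dbox.1 hk j
      constructor <;> simp <;> omega
    have hbox : dbox (fun j => (k j - 1) * M j + 1) (fun j => k j * M j)
        = tile M (fun j => k j - 1) := by
      simp [tile]
    rw [hbox]
    have h0 := hzero ψ hψ _ hkK
    refine ⟨napply_eq_of_energy_eq_zero (htile _) h0, ?_⟩
    have hne := htile_ne fun j => k j - 1
    exact le_antisymm (nmin_le ⟨_, hne, (hψpos _ (htileS _ hkK hne)).ne'⟩ h0.le)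
      (le_nmin ⟨_, hne⟩ (htile _))
end
end

section
/- Let d = 1, let q : ℤ → ℝ be supported in [1,b_1] and reflection symmetric there (q(x) = q(b_1−x+1)), and let a ∈ [0, M_1−b_1] ∩ ℤ with a ≠ (M_1−b_1)/2. If ψ is the strictly positive ground state of h^N_{0,[1,M_1]} + q_a with ground state eigenvalue E and E ≠ −2, then ψ(1) ≠ ψ(M_1). -/
open scoped BigOperators

noncomputable section

/-- The set of nearest neighbors of a point of `ℤ`. -/
def nbhd1 (n : ℤ) : Finset ℤ := {n - 1, n + 1}

/-- `n_S(i)`: the number of nearest neighbors of `i` lying outside `S ⊂ ℤ`. -/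
def nOut1 (S : Finset ℤ) (i : ℤ) : ℕ :=
  ((nbhd1 i).filter fun j => j ∉ S).card

/-- The matrix of the one-dimensional Neumann Laplacian `h^N_{0,S}` plus a potential
`V` on the finite set `S ⊂ ℤ`. -/
def neumannMat1 (S : Finset ℤ) (V : ℤ → ℝ) : Matrix S S ℝ :=
  fun i j => (if |(i : ℤ) - (j : ℤ)| = 1 then (-1 : ℝ) else 0)
    + (if i = j then (V (i : ℤ) - (nOut1 S (i : ℤ) : ℝ)) else 0)

/-- The pointwise action of `h^N_{0,S} + V` on a function `u : ℤ → ℝ` at `i ∈ S`. -/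
def napply1 (S : Finset ℤ) (V : ℤ → ℝ) (u : ℤ → ℝ) (i : ℤ) : ℝ :=
  (-∑ j ∈ S.filter (fun j => |i - j| = 1), u j) - (nOut1 S i : ℝ) * u i + V i * u i

/-- A solution of `T (i + 1) + T (i - 1) = (μ + 2) * T i` with equal initial values that stays
positive moves strictly away from them, in the direction given by the sign of `μ`. -/
lemma mul_sub_pos_of_recurrence {T : ℕ → ℝ} {μ : ℝ} (hμ : μ ≠ 0) {R : ℕ} (h0 : T 0 = T 1)
    (hpos : ∀ i ≤ R, 0 < T i)
    (hrec : ∀ i, i + 1 ≤ R → T (i + 2) + T i = (μ + 2) * T (i + 1)) :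
    ∀ i, i + 1 ≤ R → 0 < μ * (T (i + 2) - T (i + 1)) := by
  intro i
  induction i with
  | zero =>
    intro hi
    have h := hrec 0 hi
    have hp := mul_pos (mul_self_pos.2 hμ) (hpos 1 hi)
    simp only [zero_add] at h ⊢
    have hT : T 2 = (μ + 2) * T 1 - T 1 := by linarith
    rw [hT]
    linarith
  | succ i ih =>
    intro hi
    have h := hrec (i + 1) hi
    have hp := mul_pos (mul_self_pos.2 hμ) (hpos (i + 1 + 1) hi)
    have hlast := ih (by omega)
    have key : μ * (T (i + 1 + 2) - T (i + 1 + 1))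
        = μ * μ * T (i + 1 + 1) + μ * (T (i + 2) - T (i + 1)) := by
      have : T (i + 1 + 2) = (μ + 2) * T (i + 1 + 1) - T (i + 1) := by linarith
      rw [this]; ring
    linarith

lemma mul_sub_nonneg_of_recurrence {T : ℕ → ℝ} {μ : ℝ} (hμ : μ ≠ 0) {R : ℕ} (h0 : T 0 = T 1)
    (hpos : ∀ i ≤ R, 0 < T i)
    (hrec : ∀ i, i + 1 ≤ R → T (i + 2) + T i = (μ + 2) * T (i + 1)) {L : ℕ} (hLR : L ≤ R) :
    0 ≤ μ * (T R - T L) := by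
  have hstep := mul_sub_pos_of_recurrence hμ h0 hpos hrec
  suffices ∀ k, L + k ≤ R → 0 ≤ μ * (T (L + k) - T L) by
    simpa [Nat.add_sub_cancel' hLR] using this (R - L) (by omega)
  intro k
  induction k with
  | zero => simp
  | succ k ih =>
    intro hk
    have h1 := ih (by omega)
    have h2 : 0 ≤ μ * (T (L + k + 1) - T (L + k)) := by
      rcases hLk : L + k with _ | j
      · simp [h0]
      · exact (hstep j (by omega)).le
    rw [← add_assoc]
    linarith

/-- The Casoratian of a solution and its shift by `n`. -/
lemma casoratian_shift_eq {T : ℕ → ℝ} {μ : ℝ} {n : ℕ} (h0 : T 0 = T 1) :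
    ∀ L, (∀ i, i + 1 ≤ L + n → T (i + 2) + T i = (μ + 2) * T (i + 1)) →
      T (L + n + 1) * T L - T (L + 1) * T (L + n) = T 0 * (T (n + 1) - T n) := by
  intro L
  induction L with
  | zero => intro _; simp only [zero_add, ← h0]; ring
  | succ L ih =>
    intro hrec
    rw [← ih fun i hi => hrec i (by omega)]
    have h1 := hrec L (by omega)
    have h2 := hrec (L + n) (by omega)
    have e1 : L + 1 + n + 1 = L + n + 2 := by omega
    have e2 : L + 1 + n = L + n + 1 := by omega
    rw [e1, e2]
    linear_combination T (L + 1) * h2 - T (L + n + 1) * h1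

/-- If the Casoratian of a positive solution and its reflection about the centre of an interval on
which the potential is symmetric has the sign opposite to `μ`, so has the increment of the solution
across the interval. -/
lemma mul_sub_neg_of_casoratian {φ V : ℤ → ℝ} {a : ℤ} {b : ℕ} {μ : ℝ}
    (hsym : ∀ i, V (2 * a + b + 1 - i) = V i)
    (hpos : ∀ i, a ≤ i → i ≤ a + b + 1 → 0 < φ i)
    (hrec : ∀ i, a + 1 ≤ i → i ≤ a + b → φ (i + 1) + φ (i - 1) = V i * φ i)
    (hW : μ * (φ (a + 1) * φ (a + b + 1) - φ a * φ (a + b)) < 0) :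
    μ * (φ (a + b + 1) - φ a) < 0 := by
  set χ : ℤ → ℝ := fun i => φ (2 * a + b + 1 - i) with hχ
  have hχpos : ∀ i, a ≤ i → i ≤ a + b + 1 → 0 < χ i := fun i h1 h2 =>
    hpos _ (by omega) (by omega)
  have hχrec : ∀ i, a + 1 ≤ i → i ≤ a + b → χ (i + 1) + χ (i - 1) = V i * χ i := by
    intro i h1 h2
    have h := hrec (2 * a + b + 1 - i) (by omega) (by omega)
    rw [hsym] at h
    simp only [hχ]
    rw [← h, add_comm]
    congr 2 <;> ring
  have hconst : ∀ k : ℕ, k ≤ b →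
      φ (a + k + 1) * χ (a + k) - φ (a + k) * χ (a + k + 1)
        = φ (a + 1) * φ (a + b + 1) - φ a * φ (a + b) := by
    intro k
    induction k with
    | zero =>
      intro _
      simp only [hχ, Nat.cast_zero, add_zero]
      congr 3 <;> ring
    | succ k ih =>
      intro hk
      rw [← ih (by omega)]
      have h1 := hrec (a + k + 1) (by omega) (by omega)
      have h2 := hχrec (a + k + 1) (by omega) (by omega)
      push_cast
      rw [← add_assoc a (k : ℤ) 1]
      simp only [add_sub_cancel_right] at h1 h2
      linear_combination χ (a + k + 1) * h1 - φ (a + k + 1) * h2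
  have hratio : ∀ k : ℕ, k ≤ b → μ * (φ (a + k + 1) / χ (a + k + 1)) < μ * (φ a / χ a) := by
    have hstep : ∀ k : ℕ, k ≤ b →
        μ * (φ (a + k + 1) / χ (a + k + 1)) < μ * (φ (a + k) / χ (a + k)) := by
      intro k hk
      have p1 := hχpos (a + k) (by omega) (by omega)
      have p2 := hχpos (a + k + 1) (by omega) (by omega)
      rw [← hconst k hk] at hW
      rw [← mul_div_assoc, ← mul_div_assoc, div_lt_div_iff₀ p2 p1]
      linarith
    intro k
    induction k with
    | zero => simpa using hstep 0
    | succ k ih =>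
      intro hk
      have h := hstep (k + 1) hk
      push_cast at h ⊢
      rw [← add_assoc a (k : ℤ) 1] at h ⊢
      exact h.trans (ih (by omega))
  have hfin := hratio b le_rfl
  have px := hpos a (by omega) (by omega)
  have py := hpos (a + b + 1) (by omega) (by omega)
  have e1 : χ (a + b + 1) = φ a := by simp only [hχ]; congr 1; ring
  have e2 : χ a = φ (a + b + 1) := by simp only [hχ]; congr 1; ring
  rw [e1, e2, ← mul_div_assoc, ← mul_div_assoc, div_lt_div_iff₀ px py] at hfin
  have : μ * (φ (a + b + 1) - φ a) * (φ (a + b + 1) + φ a) < 0 := by linarith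
  exact neg_of_mul_neg_left this (by positivity)

/-- Equal endpoint values force `E = -2` when the block lies closer to the left endpoint. -/
lemma energy_eq_of_endpoints_eq {φ V : ℤ → ℝ} {M a : ℤ} {b : ℕ} {E : ℝ}
    (ha0 : 0 ≤ a) (hamid : 2 * a < M - b)
    (hsupp : ∀ i, i ≤ a ∨ a + b < i → V i = 0)
    (hsym : ∀ i, V (2 * a + b + 1 - i) = V i)
    (hl : φ 0 = φ 1) (hr : φ (M + 1) = φ M) (hlr : φ 1 = φ M)
    (hpos : ∀ i, 0 ≤ i → i ≤ M + 1 → 0 < φ i)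
    (hrec : ∀ i, 1 ≤ i → i ≤ M → φ (i + 1) + φ (i - 1) = (V i - E) * φ i) :
    E = -2 := by
  by_contra hE
  obtain ⟨L, rfl⟩ := Int.eq_ofNat_of_zero_le ha0
  obtain ⟨R, hR⟩ := Int.eq_ofNat_of_zero_le (show 0 ≤ M - L - b by omega)
  obtain ⟨n, rfl⟩ : ∃ n, R = L + (n + 1) := ⟨R - L - 1, by omega⟩
  obtain rfl : M = L + b + (L + (n + 1) : ℕ) := by omega
  set M : ℤ := L + b + (L + (n + 1) : ℕ) with hM
  have hμ : -E - 2 ≠ 0 := fun h => hE (by linarith)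
  set T : ℕ → ℝ := fun i => φ (M + 1 - i) with hT
  have hT0 : T 0 = T 1 := by simp [hT, hr]
  have hTpos : ∀ i ≤ L + (n + 1), 0 < T i := fun i hi => hpos _ (by omega) (by omega)
  have hTrec : ∀ i, i + 1 ≤ L + (n + 1) →
      T (i + 2) + T i = (-E - 2 + 2) * T (i + 1) := by
    intro i hi
    have h := hrec (M + 1 - (i + 1 : ℕ)) (by omega) (by omega)
    rw [hsupp _ (Or.inr (by omega))] at h
    simp only [hT]
    have e1 : M + 1 - ((i + 1 : ℕ) : ℤ) + 1 = M + 1 - i := by omega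
    have e2 : M + 1 - ((i + 1 : ℕ) : ℤ) - 1 = M + 1 - (i + 2 : ℕ) := by omega
    rw [e1, e2] at h
    linarith
  have hφT : ∀ i : ℕ, i ≤ L → φ i = T i ∧ φ (i + 1) = T (i + 1) := by
    intro i
    induction i with
    | zero => intro _; simp [hT, hl, hlr, hr]
    | succ i ih =>
      intro hi
      obtain ⟨h1, h2⟩ := ih (by omega)
      have h := hrec (i + 1) (by omega) (by omega)
      rw [hsupp _ (Or.inl (by omega)), add_sub_cancel_right] at h
      have h' := hTrec i (by omega)
      push_cast
      refine ⟨h2, ?_⟩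
      have e : i + 1 + 1 = i + 2 := rfl
      rw [e]
      rw [h1, h2] at h
      linarith
  obtain ⟨hL, hL1⟩ := hφT L le_rfl
  have eR : φ (L + b + 1) = T (L + (n + 1)) := by simp only [hT]; congr 1; omega
  have eR1 : φ (L + b) = T (L + (n + 1) + 1) := by simp only [hT]; congr 1; omega
  have hcas := casoratian_shift_eq (n := n + 1) hT0 L hTrec
  have hinc := mul_sub_pos_of_recurrence hμ hT0 hTpos hTrec n (by omega)
  have hmono := mul_sub_nonneg_of_recurrence hμ hT0 hTpos hTrec (show L ≤ L + (n + 1) by omega)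
  have hneg := mul_sub_neg_of_casoratian (φ := φ) (V := fun i => V i - E) (a := L) (b := b)
    (μ := -E - 2) (fun i => by simp only [hsym]) (fun i _ _ => hpos i (by omega) (by omega))
    (fun i _ _ => hrec i (by omega) (by omega)) (by
      rw [hL, hL1, eR, eR1]
      have := mul_pos (hTpos 0 (by omega)) hinc
      have e : T (n + 1 + 1) = T (n + 2) := rfl
      rw [e] at hcas
      linear_combination this - (-E - 2) * hcas)
  rw [eR, hL] at hneg
  linarith

lemma filter_adj_Icc_sum {M : ℤ} (u : ℤ → ℝ) {i : ℤ} (hi : i ∈ Finset.Icc 1 M) :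
    ∑ j ∈ (Finset.Icc 1 M).filter (fun j => |i - j| = 1), u j
      = (if 1 < i then u (i - 1) else 0) + (if i < M then u (i + 1) else 0) := by
  rw [Finset.mem_Icc] at hi
  have : (Finset.Icc 1 M).filter (fun j => |i - j| = 1)
      = ({i - 1, i + 1} : Finset ℤ).filter (fun j => 1 ≤ j ∧ j ≤ M) := by
    ext j
    simp only [Finset.mem_filter, Finset.mem_Icc, Finset.mem_insert, Finset.mem_singleton,
      abs_eq (zero_le_one' ℤ)]
    omega
  rw [this, Finset.sum_filter, Finset.sum_pair (by omega)]
  congr 1 <;> refine if_congr (by omega) rfl rfl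

lemma nOut1_Icc {M : ℤ} {i : ℤ} (hi : i ∈ Finset.Icc 1 M) :
    (nOut1 (Finset.Icc 1 M) i : ℝ) = (if 1 < i then 0 else 1) + (if i < M then 0 else 1) := by
  rw [Finset.mem_Icc] at hi
  have h : nOut1 (Finset.Icc 1 M) i = (if 1 < i then 0 else 1) + (if i < M then 0 else 1) := by
    rw [nOut1, nbhd1, Finset.card_filter, Finset.sum_pair (by omega)]
    simp only [Finset.mem_Icc]
    split_ifs <;> omega
  rw [h]; push_cast; rfl

/-- The extension of a function on `[1, M]` by its endpoint values. -/
def neumannExt (M : ℤ) (u : ℤ → ℝ) (i : ℤ) : ℝ := u (max 1 (min M i))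

lemma napply1_Icc {M : ℤ} (V u : ℤ → ℝ) {i : ℤ} (hi : i ∈ Finset.Icc 1 M) :
    napply1 (Finset.Icc 1 M) V u i
      = V i * neumannExt M u i - (neumannExt M u (i + 1) + neumannExt M u (i - 1)) := by
  rw [napply1, filter_adj_Icc_sum u hi, nOut1_Icc hi]
  rw [Finset.mem_Icc] at hi
  have e0 : max 1 (min M i) = i := by omega
  have e1 : max 1 (min M (i + 1)) = if i < M then i + 1 else i := by split_ifs <;> omega
  have e2 : max 1 (min M (i - 1)) = if 1 < i then i - 1 else i := by split_ifs <;> omega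
  simp only [neumannExt, e0, e1, e2]
  split_ifs <;> ring

/-- **The ground state has unequal values at the endpoints.**  Let `q` be supported in
`[1, b₁]` and reflection symmetric there, let `a ∈ [0, M₁ - b₁]` with
`a ≠ (M₁ - b₁)/2`.  If `ψ` is the strictly positive ground state of
`h^N_{0,[1,M₁]} + q_a` with ground state eigenvalue `E` and `E ≠ -2`, then
`ψ(1) ≠ ψ(M₁)`. -/
theorem ground_state_unequal_at_endpoints
    (M b : ℤ) (hb : 1 ≤ b) (hbM : b ≤ M)
    (q : ℤ → ℝ)
    (hsupp : ∀ n, n ∉ Finset.Icc 1 b → q n = 0)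
    (hsym : ∀ x : ℤ, q x = q (b - x + 1))
    (a : ℤ) (ha0 : 0 ≤ a) (haM : a ≤ M - b) (hamid : 2 * a ≠ M - b)
    (E : ℝ)
    (hE : E = sInf (spectrum ℝ (neumannMat1 (Finset.Icc 1 M) (fun n => q (n - a)))))
    (hEne : E ≠ -2)
    (ψ : ℤ → ℝ)
    (hψpos : ∀ i ∈ Finset.Icc (1 : ℤ) M, 0 < ψ i)
    (hψeq : ∀ i ∈ Finset.Icc (1 : ℤ) M,
      napply1 (Finset.Icc 1 M) (fun n => q (n - a)) ψ i = E * ψ i) :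
    ψ 1 ≠ ψ M := by
  intro hends
  obtain ⟨c, rfl⟩ := Int.eq_ofNat_of_zero_le (show 0 ≤ b by omega)
  set φ := neumannExt M ψ with hφ
  have hM1 : 1 ≤ M := by omega
  have hl : φ 0 = φ 1 := by simp only [hφ, neumannExt]; congr 1; omega
  have hr : φ (M + 1) = φ M := by simp only [hφ, neumannExt]; congr 1; omega
  have hlr : φ 1 = φ M := by simp [hφ, neumannExt, hM1, hends]
  have hpos : ∀ i, 0 < φ i := fun i => hψpos _ (by rw [Finset.mem_Icc]; omega)
  have hrec : ∀ i, 1 ≤ i → i ≤ M → φ (i + 1) + φ (i - 1) = (q (i - a) - E) * φ i := by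
    intro i h1 h2
    have hi : i ∈ Finset.Icc 1 M := Finset.mem_Icc.2 ⟨h1, h2⟩
    have h := hψeq i hi
    have hφi : φ i = ψ i := by simp only [hφ, neumannExt]; congr 1; omega
    rw [napply1_Icc _ _ hi, ← hφ, ← hφi] at h
    linarith
  rcases lt_or_gt_of_ne hamid with hlt | hgt
  · refine hEne (energy_eq_of_endpoints_eq (φ := φ) (V := fun i => q (i - a)) (M := M) (a := a)
      (b := c) ha0 hlt (fun i hi => hsupp _ ?_) (fun i => ?_) hl hr hlr (fun i _ _ => hpos i) hrec)
    · rw [Finset.mem_Icc]; omega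
    · rw [hsym (i - a)]; congr 1; ring
  · refine hEne (energy_eq_of_endpoints_eq (φ := fun i => φ (M + 1 - i))
      (V := fun i => q (M + 1 - i - a)) (M := M) (a := M - a - c) (b := c) (by omega) (by omega)
      (fun i hi => hsupp _ ?_) (fun i => ?_) ?_ ?_ ?_ (fun i _ _ => hpos _) ?_)
    · rw [Finset.mem_Icc]; omega
    · rw [hsym (M + 1 - i - a)]; congr 1; ring
    · simpa using hr
    · simpa using hl
    · simpa using hlr.symm
    · intro i h1 h2
      rw [← hrec (M + 1 - i) (by omega) (by omega), add_comm]
      congr 2 <;> ring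
end
end
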